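/- (Critical position under global monotonicity of f.) In the setting of Theorem 2.3 with fixed direction e ∈ ∂B₁(0), but assuming additionally that f is non-increasing on the whole interval [0,A] and requiring only 0 ≤ u ≤ A (instead of 0 ≤ u < A on ℝ^d∖G), one has λ* = λ₀, where λ₀ is the largest λ at which Situation 1 or Situation 2 occurs and λ* = inf{λ ≥ λ₀ : v_μ ≥ 0 in H^μ for all μ > λ}. -/

import Mathlib

open MeasureTheory Set Filter Metric Asymptotics
open scoped RealInnerProductSpace ENNReal Topology NNReal

noncomputable section

abbrev Rd (d : ℕ) := EuclideanSpace ℝ (Fin d)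

/-- The data of a Bernstein function `Ψ` vanishing at `0`, its Lévy measure `𝔪`,
and the weak scaling conditions. -/
structure PsiSetting (d : ℕ) where
  Ψ : ℝ → ℝ
  m : Measure ℝ
  m_onIoi : m (Set.Iic 0) = 0
  smooth : ContDiffOn ℝ (⊤ : ℕ∞) Ψ (Set.Ioi 0)
  nonneg : ∀ x > (0:ℝ), 0 ≤ Ψ x
  deriv_alt : ∀ n : ℕ, ∀ x > (0:ℝ),
    (-1 : ℝ) ^ (n + 1) * iteratedDerivWithin (n + 1) Ψ (Set.Ioi 0) x ≤ 0
  zero_lim : Filter.Tendsto Ψ (nhdsWithin 0 (Set.Ioi 0)) (nhds 0)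
  levy_rep : ∀ lam > (0:ℝ), Ψ lam = ∫ t, (1 - Real.exp (-lam * t)) ∂m
  a₁ : ℝ
  a₂ : ℝ
  b₁ : ℝ
  b₂ : ℝ
  ha₁ : 0 < a₁
  ha₁₂ : a₁ ≤ a₂
  ha₂ : a₂ < 1
  hb₁ : 1 ≤ b₁
  hb₂ : 1 < b₂
  scaling_lower : ∀ r R : ℝ, 1 ≤ r → r ≤ R → (1 / b₁) * (R / r) ^ a₁ ≤ Ψ R / Ψ r
  scaling_upper : ∀ r R : ℝ, 1 ≤ r → r ≤ R → Ψ R / Ψ r ≤ b₁ * (R / r) ^ a₂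

/-- The jump kernel `j(r) = ∫_0^∞ (4πt)^{-d/2} e^{-r²/(4t)} 𝔪(dt)`. -/
def PsiSetting.j {d : ℕ} (S : PsiSetting d) (r : ℝ) : ℝ :=
  ∫ t, (4 * Real.pi * t) ^ (-(d : ℝ) / 2) * Real.exp (-(r ^ 2) / (4 * t)) ∂S.m

/-- The condition `j(r) ≤ b₂ j(r+1)` for `r ≥ 1`. -/
def PsiSetting.kernelCond {d : ℕ} (S : PsiSetting d) : Prop :=
  ∀ r : ℝ, 1 ≤ r → S.j r ≤ S.b₂ * S.j (r + 1)

/-- The nonlocal operator `Ψ(−Δ)` applied to a test function. -/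
def psiOp {d : ℕ} (S : PsiSetting d) (φ : Rd d → ℝ) (x : Rd d) : ℝ :=
  ∫ z : Rd d,
    (φ x - φ (x + z) + (if ‖z‖ ≤ 1 then ⟪z, gradient φ x⟫ else 0)) * S.j ‖z‖

/-- Admissible test functions at `x`: bounded continuous and C² near `x`. -/
def TestAt {d : ℕ} (x : Rd d) (φ : Rd d → ℝ) : Prop :=
  (∃ M, ∀ y, |φ y| ≤ M) ∧ Continuous φ ∧ ∃ U ∈ nhds x, ContDiffOn ℝ 2 φ U

/-- Viscosity supersolution of `Ψ(−Δ)u + c·u = g` in `Ω`. -/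
def IsSuperSol {d : ℕ} (S : PsiSetting d) (Ω : Set (Rd d)) (c g u : Rd d → ℝ) : Prop :=
  LowerSemicontinuous u ∧
    ∀ x ∈ Ω, ∀ φ : Rd d → ℝ, TestAt x φ → φ x = u x → (∀ y, y ≠ x → φ y < u y) →
      g x ≤ psiOp S φ x + c x * u x

/-- Viscosity subsolution of `Ψ(−Δ)u + c·u = g` in `Ω`. -/
def IsSubSol {d : ℕ} (S : PsiSetting d) (Ω : Set (Rd d)) (c g u : Rd d → ℝ) : Prop :=
  UpperSemicontinuous u ∧
    ∀ x ∈ Ω, ∀ φ : Rd d → ℝ, TestAt x φ → φ x = u x → (∀ y, y ≠ x → u y < φ y) →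
      psiOp S φ x + c x * u x ≤ g x

/-- Viscosity solution of `Ψ(−Δ)u + c·u = g` in `Ω`. -/
def IsSol {d : ℕ} (S : PsiSetting d) (Ω : Set (Rd d)) (c g u : Rd d → ℝ) : Prop :=
  IsSubSol S Ω c g u ∧ IsSuperSol S Ω c g u

/-- `V` is the renewal function of the ascending ladder-height process associated with `Ψ`. -/
structure IsRenewal (Ψ V : ℝ → ℝ) : Prop where
  nonneg : ∀ x, 0 ≤ V x
  zero : ∀ x ≤ (0:ℝ), V x = 0
  cont : ContinuousOn V (Set.Ioi 0)
  mono : StrictMonoOn V (Set.Ioi 0)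
  laplace : ∀ s : ℝ, 0 < s →
    (∫ x in Set.Ioi (0 : ℝ), V x * Real.exp (-s * x)) =
      1 / (s * Real.exp ((1 / Real.pi) *
        ∫ y in Set.Ioi (0 : ℝ), Real.log (Ψ (s * y)) / (1 + y ^ 2)))

/-- `tr_V(u)(x) = t`: the `V`-trace of `u` at the boundary point `x` of `D`. -/
def HasVTrace {d : ℕ} (V : ℝ → ℝ) (D : Set (Rd d)) (u : Rd d → ℝ)
    (x : Rd d) (t : ℝ) : Prop :=
  Filter.Tendsto (fun z => u z / V (Metric.infDist z Dᶜ)) (nhdsWithin x D) (nhds t)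

/-- An open set has C² boundary. -/
def HasC2Boundary {d : ℕ} (D : Set (Rd d)) : Prop :=
  ∀ x ∈ frontier D, ∃ (U : Set (Rd d)) (f : Rd d → ℝ),
    IsOpen U ∧ x ∈ U ∧ ContDiffOn ℝ 2 f U ∧ (∀ y ∈ U, fderiv ℝ f y ≠ 0) ∧
      D ∩ U = {y ∈ U | f y < 0}

/-- A closed set has C² boundary. -/
def HasC2BoundaryClosed {d : ℕ} (G : Set (Rd d)) : Prop :=
  ∀ x ∈ frontier G, ∃ (U : Set (Rd d)) (f : Rd d → ℝ),
    IsOpen U ∧ x ∈ U ∧ ContDiffOn ℝ 2 f U ∧ (∀ y ∈ U, fderiv ℝ f y ≠ 0) ∧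
      G ∩ U = {y ∈ U | f y ≤ 0}

/-- Reflection `R_{λ,e}` across the hyperplane `{x·e = λ}`. -/
def reflAt {d : ℕ} (e : Rd d) (lam : ℝ) (x : Rd d) : Rd d :=
  x - (2 * ⟪x, e⟫ - 2 * lam) • e

/-- The open half-space `H_{λ,e} = {x·e > λ}`. -/
def halfSpace {d : ℕ} (e : Rd d) (lam : ℝ) : Set (Rd d) := {x | lam < ⟪x, e⟫}

/-- A function is antisymmetric with respect to the half-space `H_{λ,e}`. -/
def AntiSym {d : ℕ} (e : Rd d) (lam : ℝ) (u : Rd d → ℝ) : Prop :=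
  ∀ x, u x = - u (reflAt e lam x)

/-- The hyperplane `{x·e = λ}` is orthogonal to `∂G` at `p` (expressed through
a local C² defining function of `G` near `p`). -/
def OrthAt {d : ℕ} (G : Set (Rd d)) (e p : Rd d) : Prop :=
  ∃ (U : Set (Rd d)) (f : Rd d → ℝ), IsOpen U ∧ p ∈ U ∧ ContDiffOn ℝ 2 f U ∧
    fderiv ℝ f p ≠ 0 ∧ G ∩ U = {y ∈ U | f y ≤ 0} ∧ fderiv ℝ f p e = 0

/-- Situation 1: a touching point `p₀ ∈ ∂G ∩ ∂R_{λ,e}(G ∩ H_{λ,e})` away from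
the hyperplane `{x·e = λ}`. -/
def Sit1 {d : ℕ} (G : Set (Rd d)) (e : Rd d) (lam : ℝ) : Prop :=
  ∃ p, p ∈ frontier G ∧
    p ∈ frontier (reflAt e lam '' (G ∩ halfSpace e lam)) ∧ ⟪p, e⟫ ≠ lam

/-- Situation 2: the hyperplane `{x·e = λ}` is orthogonal to `∂G` at some
point `p₀ ∈ ∂G ∩ {x·e = λ}`. -/
def Sit2 {d : ℕ} (G : Set (Rd d)) (e : Rd d) (lam : ℝ) : Prop :=
  ∃ p, p ∈ frontier G ∧ ⟪p, e⟫ = lam ∧ OrthAt G e p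

/-- The Gauss kernel `(4πt)^{-d/2} e^{-r²/(4t)}`. -/
def gaussKernel (d : ℕ) (r t : ℝ) : ℝ :=
  (4 * Real.pi * t) ^ (-(d : ℝ) / 2) * Real.exp (-(r ^ 2) / (4 * t))

/-- The truncated square `1 ∧ |z|²`. -/
def levyWeight {d : ℕ} (z : Rd d) : ℝ := min 1 (‖z‖ ^ 2)

lemma levyWeight_nonneg {d : ℕ} (z : Rd d) : 0 ≤ levyWeight z := by
  unfold levyWeight; positivity

lemma levyWeight_le_one {d : ℕ} (z : Rd d) : levyWeight z ≤ 1 := min_le_left _ _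

lemma continuous_levyWeight {d : ℕ} : Continuous (levyWeight (d := d)) := by
  unfold levyWeight; fun_prop

lemma levyWeight_eq_sq {d : ℕ} {z : Rd d} (hz : ‖z‖ ≤ 1) : levyWeight z = ‖z‖ ^ 2 :=
  min_eq_right (by nlinarith [norm_nonneg z])

lemma gaussKernel_pos (d : ℕ) (r : ℝ) {t : ℝ} (ht : 0 < t) : 0 < gaussKernel d r t := by
  unfold gaussKernel; positivity

lemma gaussKernel_le_gaussKernel (d : ℕ) {r s t : ℝ} (ht : 0 < t) (hr : 0 ≤ r) (hrs : r ≤ s) :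
    gaussKernel d s t ≤ gaussKernel d r t := by
  unfold gaussKernel
  gcongr

lemma integral_exp_neg_sq_div {d : ℕ} {c : ℝ} (hc : 0 < c) :
    ∫ z : Rd d, Real.exp (-(‖z‖ ^ 2) / c) = (Real.pi * c) ^ ((d : ℝ) / 2) := by
  have h := GaussianFourier.integral_rexp_neg_mul_sq_norm (V := Rd d) (b := 1 / c) (by positivity)
  rw [finrank_euclideanSpace_fin] at h
  convert h using 2
  · ext z; congr 1; ring
  · field_simp

lemma integrable_exp_neg_sq_div {d : ℕ} {c : ℝ} (hc : 0 < c) :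
    Integrable fun z : Rd d => Real.exp (-(‖z‖ ^ 2) / c) := by
  by_contra h
  have h0 := integral_exp_neg_sq_div (d := d) hc
  rw [integral_undef h] at h0
  have : 0 < (Real.pi * c) ^ ((d : ℝ) / 2) := by positivity
  exact this.ne h0

lemma integrable_levyWeight_mul_gaussKernel {d : ℕ} {t : ℝ} (ht : 0 < t) :
    Integrable fun z : Rd d => levyWeight z * gaussKernel d ‖z‖ t := by
  have h := (integrable_exp_neg_sq_div (d := d) (c := 4 * t) (by positivity)).const_mul
    ((4 * Real.pi * t) ^ (-(d : ℝ) / 2))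
  refine h.bdd_mul (c := 1) continuous_levyWeight.aestronglyMeasurable (ae_of_all _ fun z => ?_)
  rw [Real.norm_of_nonneg (levyWeight_nonneg z)]
  exact levyWeight_le_one z

lemma integral_levyWeight_mul_gaussKernel_le_one {d : ℕ} {t : ℝ} (ht : 0 < t) :
    ∫ z : Rd d, levyWeight z * gaussKernel d ‖z‖ t ≤ 1 := by
  have h4 : (0 : ℝ) < 4 * t := by positivity
  calc ∫ z : Rd d, levyWeight z * gaussKernel d ‖z‖ t
      ≤ ∫ z : Rd d, (4 * Real.pi * t) ^ (-(d : ℝ) / 2) * Real.exp (-(‖z‖ ^ 2) / (4 * t)) := by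
        refine integral_mono (integrable_levyWeight_mul_gaussKernel ht)
          ((integrable_exp_neg_sq_div h4).const_mul _) fun z => ?_
        exact mul_le_of_le_one_left (gaussKernel_pos d _ ht).le (levyWeight_le_one z)
    _ = 1 := by
        rw [integral_const_mul, integral_exp_neg_sq_div h4,
          show Real.pi * (4 * t) = 4 * Real.pi * t by ring, ← Real.rpow_add (by positivity)]
        ring_nf
        exact Real.rpow_zero _

lemma integral_levyWeight_mul_gaussKernel_le_mul {d : ℕ} {t : ℝ} (ht : 0 < t) :
    ∫ z : Rd d, levyWeight z * gaussKernel d ‖z‖ t ≤ 8 * (2 : ℝ) ^ ((d : ℝ) / 2) * t := by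
  have h8 : (0 : ℝ) < 8 * t := by positivity
  calc ∫ z : Rd d, levyWeight z * gaussKernel d ‖z‖ t
      ≤ ∫ z : Rd d, (8 * t * (4 * Real.pi * t) ^ (-(d : ℝ) / 2)) *
          Real.exp (-(‖z‖ ^ 2) / (8 * t)) := by
        refine integral_mono (integrable_levyWeight_mul_gaussKernel ht)
          ((integrable_exp_neg_sq_div h8).const_mul _) fun z => ?_
        have hw : levyWeight z ≤ ‖z‖ ^ 2 := min_le_right _ _
        have hs : ‖z‖ ^ 2 / (8 * t) * Real.exp (-(‖z‖ ^ 2) / (8 * t)) ≤ 1 := by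
          rw [neg_div]
          set s := ‖z‖ ^ 2 / (8 * t)
          have h1 := Real.add_one_le_exp s
          rw [Real.exp_neg]
          exact mul_inv_le_one_of_le₀ (by linarith) (Real.exp_pos s).le
        have hexp : Real.exp (-(‖z‖ ^ 2) / (4 * t)) =
            Real.exp (-(‖z‖ ^ 2) / (8 * t)) * Real.exp (-(‖z‖ ^ 2) / (8 * t)) := by
          rw [← Real.exp_add]; congr 1; field_simp; ring
        have hsq : ‖z‖ ^ 2 * Real.exp (-(‖z‖ ^ 2) / (8 * t)) ≤ 8 * t := by
          have := mul_le_mul_of_nonneg_left hs h8.le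
          calc _ = 8 * t * (‖z‖ ^ 2 / (8 * t) * Real.exp (-(‖z‖ ^ 2) / (8 * t))) := by
                field_simp
            _ ≤ _ := by linarith
        have hp : 0 < (4 * Real.pi * t) ^ (-(d : ℝ) / 2) := by positivity
        simp only [gaussKernel]
        rw [hexp]
        calc _ ≤ ‖z‖ ^ 2 * ((4 * Real.pi * t) ^ (-(d : ℝ) / 2) *
              (Real.exp (-(‖z‖ ^ 2) / (8 * t)) * Real.exp (-(‖z‖ ^ 2) / (8 * t)))) := by
              gcongr
          _ = (‖z‖ ^ 2 * Real.exp (-(‖z‖ ^ 2) / (8 * t))) * ((4 * Real.pi * t) ^ (-(d : ℝ) / 2) *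
              Real.exp (-(‖z‖ ^ 2) / (8 * t))) := by ring
          _ ≤ (8 * t) * ((4 * Real.pi * t) ^ (-(d : ℝ) / 2) *
              Real.exp (-(‖z‖ ^ 2) / (8 * t))) := by gcongr
          _ = _ := by ring
    _ = 8 * (2 : ℝ) ^ ((d : ℝ) / 2) * t := by
        rw [integral_const_mul, integral_exp_neg_sq_div h8,
          show Real.pi * (8 * t) = 2 * (4 * Real.pi * t) by ring,
          Real.mul_rpow (x := 2) (y := 4 * Real.pi * t) (by norm_num) (by positivity)]
        have : (4 * Real.pi * t) ^ (-(d : ℝ) / 2) * (4 * Real.pi * t) ^ ((d : ℝ) / 2) = 1 := by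
          rw [← Real.rpow_add (by positivity)]
          ring_nf
          exact Real.rpow_zero _
        linear_combination (8 * t * 2 ^ ((d : ℝ) / 2)) * this

lemma min_one_le_two_mul_one_sub_exp {t : ℝ} (ht : 0 < t) :
    min 1 t ≤ 2 * (1 - Real.exp (-t)) := by
  have h1 : Real.exp (-t) * (1 + t) ≤ 1 := by
    have := mul_le_mul_of_nonneg_left (Real.add_one_le_exp t) (Real.exp_pos (-t)).le
    rw [← Real.exp_add] at this
    simp only [neg_add_cancel, Real.exp_zero] at this
    linarith
  have h2 := Real.exp_pos (-t)
  rcases le_total t 1 with h | h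
  · rw [min_eq_right h]; nlinarith
  · rw [min_eq_left h]; nlinarith

lemma integral_levyWeight_mul_gaussKernel_le {d : ℕ} {t : ℝ} (ht : 0 < t) :
    ∫ z : Rd d, levyWeight z * gaussKernel d ‖z‖ t ≤
      16 * (2 : ℝ) ^ ((d : ℝ) / 2) * (1 - Real.exp (-t)) := by
  have h1 := integral_levyWeight_mul_gaussKernel_le_one (d := d) ht
  have h2 := integral_levyWeight_mul_gaussKernel_le_mul (d := d) ht
  have h3 : (1 : ℝ) ≤ (2 : ℝ) ^ ((d : ℝ) / 2) := Real.one_le_rpow (by norm_num) (by positivity)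
  have h4 : ∫ z : Rd d, levyWeight z * gaussKernel d ‖z‖ t ≤
      8 * (2 : ℝ) ^ ((d : ℝ) / 2) * min 1 t := by
    rcases le_total t 1 with h | h
    · rwa [min_eq_right h]
    · rw [min_eq_left h]; linarith
  calc _ ≤ _ := h4
    _ ≤ 8 * (2 : ℝ) ^ ((d : ℝ) / 2) * (2 * (1 - Real.exp (-t))) := by
        gcongr; exact min_one_le_two_mul_one_sub_exp ht
    _ = _ := by ring

namespace PsiSetting

variable {d : ℕ} (S : PsiSetting d)

lemma integral_one_sub_exp_ne_zero : ∫ t, (1 - Real.exp (-1 * t)) ∂S.m ≠ 0 := by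
  intro h
  rw [← S.levy_rep 1 one_pos] at h
  have h1 := S.scaling_lower 1 1 le_rfl le_rfl
  have h2 := S.hb₁
  simp only [h, div_one, Real.one_rpow, mul_one, div_zero] at h1
  have : 0 < 1 / S.b₁ := by positivity
  linarith

lemma integrable_one_sub_exp : Integrable (fun t => 1 - Real.exp (-t)) S.m := by
  by_contra h
  exact S.integral_one_sub_exp_ne_zero (integral_undef (by simpa using h))

lemma ae_pos : ∀ᵐ t ∂S.m, 0 < t := by
  rw [ae_iff]
  convert S.m_onIoi using 2
  ext; simp

lemma m_ne_zero : S.m ≠ 0 := by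
  intro h
  apply S.integral_one_sub_exp_ne_zero
  simp [h]

instance sigmaFinite_m : SigmaFinite S.m := by
  refine ⟨⟨⟨fun n => {t | 1 / ((n : ℝ) + 1) ≤ 1 - Real.exp (-t)} ∪ Set.Iic 0, fun _ => trivial,
    fun n => ?_, ?_⟩⟩⟩
  · refine measure_union_lt_top (S.integrable_one_sub_exp.measure_ge_lt_top (by positivity)) ?_
    rw [S.m_onIoi]; simp
  · refine Set.eq_univ_of_forall fun t => ?_
    rcases le_or_gt t 0 with h | h
    · exact Set.mem_iUnion.2 ⟨0, Or.inr h⟩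
    · have : 0 < 1 - Real.exp (-t) := by
        have := Real.exp_lt_exp.2 (neg_lt_zero.2 h); rw [Real.exp_zero] at this; linarith
      obtain ⟨n, hn⟩ := exists_nat_one_div_lt this
      exact Set.mem_iUnion.2 ⟨n, Or.inl hn.le⟩

lemma j_eq (r : ℝ) : S.j r = ∫ t, gaussKernel d r t ∂S.m := rfl

lemma measurable_gaussKernel_norm :
    Measurable fun p : Rd d × ℝ => gaussKernel d ‖p.1‖ p.2 := by
  unfold gaussKernel
  have h : Measurable fun p : Rd d × ℝ => ‖p.1‖ := measurable_fst.norm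
  refine Measurable.mul ?_ ?_
  · exact (measurable_snd.const_mul _).pow_const _
  · exact Real.measurable_exp.comp (((h.pow_const 2).neg).div (measurable_snd.const_mul _))

lemma integrable_prod_levyWeight_mul_gaussKernel :
    Integrable (fun p : Rd d × ℝ => levyWeight p.1 * gaussKernel d ‖p.1‖ p.2)
      (volume.prod S.m) := by
  have hmeas : Measurable fun p : Rd d × ℝ => levyWeight p.1 * gaussKernel d ‖p.1‖ p.2 :=
    (continuous_levyWeight.measurable.comp measurable_fst).mul measurable_gaussKernel_norm
  rw [integrable_prod_iff' hmeas.aestronglyMeasurable]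
  refine ⟨S.ae_pos.mono fun t ht => integrable_levyWeight_mul_gaussKernel ht, ?_⟩
  refine (S.integrable_one_sub_exp.const_mul (16 * (2 : ℝ) ^ ((d : ℝ) / 2))).mono' ?_ ?_
  · exact (hmeas.norm.stronglyMeasurable.integral_prod_left').aestronglyMeasurable
  · filter_upwards [S.ae_pos] with t ht
    have hn : ∀ z : Rd d, ‖levyWeight z * gaussKernel d ‖z‖ t‖ =
        levyWeight z * gaussKernel d ‖z‖ t := fun z =>
      Real.norm_of_nonneg (mul_nonneg (levyWeight_nonneg z) (gaussKernel_pos d _ ht).le)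
    simp only [hn]
    rw [Real.norm_of_nonneg (integral_nonneg fun z =>
      mul_nonneg (levyWeight_nonneg z) (gaussKernel_pos d _ ht).le)]
    exact integral_levyWeight_mul_gaussKernel_le ht

lemma integrable_levyWeight_mul_j :
    Integrable fun z : Rd d => levyWeight z * S.j ‖z‖ := by
  have h := S.integrable_prod_levyWeight_mul_gaussKernel.integral_prod_left
  simpa only [integral_const_mul, ← S.j_eq] using h

lemma measurable_j_norm : Measurable fun z : Rd d => S.j ‖z‖ :=
  (measurable_gaussKernel_norm.stronglyMeasurable.integral_prod_right').measurable

lemma integrable_gaussKernel [NeZero d] {r : ℝ} (hr : 0 < r) :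
    Integrable (gaussKernel d r) S.m := by
  have h := S.integrable_prod_levyWeight_mul_gaussKernel.prod_right_ae
  have h0 : ∀ᵐ z : Rd d, z ≠ 0 := compl_mem_ae_iff.2 (measure_singleton 0)
  obtain ⟨z, hzr, hz, hz0⟩ := (Measure.dense_of_ae (h.and h0)).exists_mem_open
    (isOpen_ball (x := (0 : Rd d)) (ε := r)) ⟨0, mem_ball_self hr⟩ |>.imp fun z hz => hz.symm
  have hw : 0 < levyWeight z := lt_min one_pos (by positivity)
  have hi : Integrable (gaussKernel d ‖z‖) S.m := by
    simpa [hw.ne'] using hz.const_mul (levyWeight z)⁻¹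
  refine hi.mono' ?_ ?_
  · unfold gaussKernel
    exact (Measurable.mul ((measurable_id.const_mul _).pow_const _)
      (Real.measurable_exp.comp (measurable_const.div (measurable_id.const_mul
        _)))).aestronglyMeasurable
  · filter_upwards [S.ae_pos] with t ht
    rw [Real.norm_of_nonneg (gaussKernel_pos d _ ht).le]
    exact gaussKernel_le_gaussKernel d ht (norm_nonneg z) (mem_ball_zero_iff.1 hzr).le

lemma j_nonneg (r : ℝ) : 0 ≤ S.j r :=
  integral_nonneg_of_ae (S.ae_pos.mono fun _ ht => (gaussKernel_pos d r ht).le)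

lemma j_pos [NeZero d] {r : ℝ} (hr : 0 < r) : 0 < S.j r := by
  rw [S.j_eq, integral_pos_iff_support_of_nonneg_ae
    (S.ae_pos.mono fun _ ht => (gaussKernel_pos d r ht).le) (S.integrable_gaussKernel hr)]
  refine pos_iff_ne_zero.2 fun h => S.m_ne_zero ?_
  rw [← ae_eq_bot, ← Filter.empty_mem_iff_bot]
  filter_upwards [S.ae_pos, compl_mem_ae_iff.2 h] with t ht ht'
  exact ht' (gaussKernel_pos d r ht).ne'

lemma j_le_j [NeZero d] {r s : ℝ} (hr : 0 < r) (hrs : r ≤ s) : S.j s ≤ S.j r :=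
  integral_mono_ae (S.integrable_gaussKernel (hr.trans_le hrs)) (S.integrable_gaussKernel hr)
    (S.ae_pos.mono fun _ ht => gaussKernel_le_gaussKernel d ht hr.le hrs)

lemma integrable_mul_j {k : Rd d → ℝ} (hk : AEStronglyMeasurable k) {D : ℝ}
    (hD : ∀ z, |k z| ≤ D * levyWeight z) : Integrable fun z => k z * S.j ‖z‖ := by
  refine (S.integrable_levyWeight_mul_j.const_mul D).mono'
    (hk.mul S.measurable_j_norm.aestronglyMeasurable) (ae_of_all _ fun z => ?_)
  rw [Real.norm_eq_abs, abs_mul, abs_of_nonneg (S.j_nonneg _), ← mul_assoc]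
  exact mul_le_mul_of_nonneg_right (hD z) (S.j_nonneg _)

lemma integrableOn_compl_ball_mul_j {r : ℝ} (hr : 0 < r) {k : Rd d → ℝ}
    (hk : AEStronglyMeasurable k) {M : ℝ} (hM : ∀ z, |k z| ≤ M) :
    IntegrableOn (fun z => k z * S.j ‖z‖) (ball 0 r)ᶜ := by
  rw [← integrable_indicator_iff measurableSet_ball.compl]
  have hm : 0 < min 1 (r ^ 2) := lt_min one_pos (by positivity)
  have hM0 : 0 ≤ M := (abs_nonneg _).trans (hM 0)
  have h := S.integrable_mul_j (D := M / min 1 (r ^ 2))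
    (hk.indicator (measurableSet_ball (x := (0 : Rd d)) (ε := r)).compl) fun z => by
      by_cases hz : z ∈ (ball (0 : Rd d) r)ᶜ
      · rw [indicator_of_mem hz, div_mul_eq_mul_div, le_div_iff₀ hm]
        have hz' : r ≤ ‖z‖ := by simpa using hz
        exact mul_le_mul (hM z) (min_le_min le_rfl (by gcongr)) hm.le hM0
      · rw [indicator_of_notMem hz, abs_zero]
        exact mul_nonneg (by positivity) (levyWeight_nonneg z)
  refine h.congr (ae_of_all _ fun z => ?_)
  by_cases hz : z ∈ (ball (0 : Rd d) r)ᶜ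
  · simp only [indicator_of_mem hz]
  · simp only [indicator_of_notMem hz, zero_mul]

end PsiSetting

/-- The compensated increment `u(x+z) - u(x) - 1_{|z|≤1} z·p`. -/
def levyDiff {d : ℕ} (u : Rd d → ℝ) (x p z : Rd d) : ℝ :=
  u (x + z) - u x - if ‖z‖ ≤ 1 then ⟪z, p⟫ else 0

lemma measurable_levyDiff {d : ℕ} {u : Rd d → ℝ} (hu : Continuous u) (x p : Rd d) :
    Measurable (levyDiff u x p) := by
  unfold levyDiff
  refine Measurable.sub (by fun_prop) (Measurable.ite ?_ (by fun_prop) measurable_const)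
  exact measurableSet_le measurable_norm measurable_const

lemma abs_ite_inner_le {d : ℕ} (p z : Rd d) : |if ‖z‖ ≤ 1 then ⟪z, p⟫ else 0| ≤ ‖p‖ := by
  split_ifs with h
  · calc |⟪z, p⟫| ≤ ‖z‖ * ‖p‖ := abs_real_inner_le_norm z p
      _ ≤ 1 * ‖p‖ := by gcongr
      _ = ‖p‖ := one_mul _
  · simp

lemma abs_levyDiff_le {d : ℕ} {u : Rd d → ℝ} {M : ℝ} (hM : ∀ x, |u x| ≤ M) (x p z : Rd d) :
    |levyDiff u x p z| ≤ 2 * M + ‖p‖ := by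
  have h1 := abs_le.1 (hM (x + z))
  have h2 := abs_le.1 (hM x)
  have h3 := abs_le.1 (abs_ite_inner_le p z)
  unfold levyDiff
  rw [abs_le]
  constructor <;> linarith [h1.1, h1.2, h2.1, h2.2, h3.1, h3.2]

/-- A continuous cutoff, equal to `1` on the ball of radius `r / 2` and to `0` off the ball of
radius `r`. -/
def cutoff {d : ℕ} (r : ℝ) (z : Rd d) : ℝ := max 0 (min 1 (2 - 2 * ‖z‖ / r))

lemma cutoff_nonneg {d : ℕ} (r : ℝ) (z : Rd d) : 0 ≤ cutoff r z := le_max_left _ _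

lemma cutoff_le_one {d : ℕ} (r : ℝ) (z : Rd d) : cutoff r z ≤ 1 :=
  max_le zero_le_one (min_le_left _ _)

lemma continuous_cutoff {d : ℕ} (r : ℝ) : Continuous (cutoff (d := d) r) := by
  unfold cutoff; fun_prop

lemma cutoff_eq_one {d : ℕ} {r : ℝ} (hr : 0 < r) {z : Rd d} (hz : ‖z‖ ≤ r / 2) :
    cutoff r z = 1 := by
  have : 2 * ‖z‖ / r ≤ 1 := by rw [div_le_one hr]; linarith
  unfold cutoff
  rw [min_eq_left (by linarith), max_eq_right zero_le_one]

lemma cutoff_eq_zero {d : ℕ} {r : ℝ} (hr : 0 < r) {z : Rd d} (hz : r ≤ ‖z‖) :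
    cutoff r z = 0 := by
  have : 2 ≤ 2 * ‖z‖ / r := by rw [le_div_iff₀ hr]; linarith
  unfold cutoff
  exact max_eq_left ((min_le_right _ _).trans (by linarith))

/-- The concave paraboloid with value `a` and slope `p` at the origin. -/
def paraboloid {d : ℕ} (a : ℝ) (p : Rd d) (C : ℝ) (z : Rd d) : ℝ := a + ⟪p, z⟫ - C * ‖z‖ ^ 2

lemma contDiff_paraboloid {d : ℕ} (a : ℝ) (p : Rd d) (C : ℝ) :
    ContDiff ℝ 2 (paraboloid a p C) := by
  unfold paraboloid
  exact (contDiff_const.add (contDiff_const.inner ℝ contDiff_id)).sub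
    (contDiff_const.mul (contDiff_norm_sq ℝ))

lemma hasGradientAt_paraboloid_sub {d : ℕ} (a : ℝ) (p : Rd d) (C : ℝ) (x : Rd d) :
    HasGradientAt (fun y => paraboloid a p C (y - x)) p x := by
  rw [hasGradientAt_iff_hasFDerivAt]
  have h1 : HasFDerivAt (fun y : Rd d => ⟪p, y - x⟫) (InnerProductSpace.toDual ℝ (Rd d) p) x :=
    ((InnerProductSpace.toDual ℝ (Rd d) p).hasFDerivAt.comp x
      ((hasFDerivAt_id x).sub_const x))
  have h2 : HasFDerivAt (fun y : Rd d => ‖y - x‖ ^ 2) (0 : Rd d →L[ℝ] ℝ) x := by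
    have := ((hasFDerivAt_id x).sub_const x).norm_sq
    simpa using this
  have := (h1.const_add a).sub (h2.const_mul C)
  rw [smul_zero, sub_zero] at this
  exact this

/-- The test function obtained from `u` by replacing it near `x` with a paraboloid. -/
def touchingTest {d : ℕ} (u : Rd d → ℝ) (x p : Rd d) (C η r : ℝ) (y : Rd d) : ℝ :=
  u y - (cutoff r (y - x) * (u y - paraboloid (u x) p C (y - x)) +
    (1 - cutoff r (y - x)) * (η * levyWeight (y - x)))

section touchingTest

variable {d : ℕ} {u : Rd d → ℝ} {x p : Rd d} {C η r : ℝ}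

lemma touchingTest_of_le (hr : 0 < r) {y : Rd d} (hy : ‖y - x‖ ≤ r / 2) :
    touchingTest u x p C η r y = paraboloid (u x) p C (y - x) := by
  simp [touchingTest, cutoff_eq_one hr hy]

lemma touchingTest_of_ge (hr : 0 < r) {y : Rd d} (hy : r ≤ ‖y - x‖) :
    touchingTest u x p C η r y = u y - η * levyWeight (y - x) := by
  simp [touchingTest, cutoff_eq_zero hr hy]

lemma touchingTest_self (hr : 0 < r) : touchingTest u x p C η r x = u x := by
  rw [touchingTest_of_le hr (by simpa using (half_pos hr).le)]
  simp [paraboloid]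

lemma continuous_touchingTest (hu : Continuous u) :
    Continuous (touchingTest u x p C η r) := by
  have h1 := (continuous_cutoff (d := d) r).comp (continuous_sub_right x)
  have h2 := (contDiff_paraboloid (u x) p C).continuous.comp (continuous_sub_right x)
  have h3 := (continuous_levyWeight (d := d)).comp (continuous_sub_right x)
  exact hu.sub ((h1.mul (hu.sub h2)).add ((continuous_const.sub h1).mul (continuous_const.mul h3)))

lemma gradient_touchingTest (hr : 0 < r) : gradient (touchingTest u x p C η r) x = p := by
  have h : touchingTest u x p C η r =ᶠ[𝓝 x] fun y => paraboloid (u x) p C (y - x) := by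
    filter_upwards [ball_mem_nhds x (half_pos hr)] with y hy
    exact touchingTest_of_le hr (mem_ball_iff_norm.1 hy).le
  rw [h.gradient_eq]
  exact (hasGradientAt_paraboloid_sub _ _ _ _).gradient

lemma abs_touchingTest_le {M : ℝ} (hr : 0 < r) (hr1 : r ≤ 1) (hη : 0 ≤ η) (hC : 0 ≤ C)
    (hM : ∀ y, |u y| ≤ M) (y : Rd d) :
    |touchingTest u x p C η r y| ≤ 2 * M + η + ‖p‖ + C := by
  have hu := abs_le.1 (hM y)
  have hx := abs_le.1 (hM x)
  have hw0 := mul_nonneg hη (levyWeight_nonneg (y - x))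
  have hw1 := mul_le_mul_of_nonneg_left (levyWeight_le_one (y - x)) hη
  rcases le_or_gt r ‖y - x‖ with h | h
  · rw [touchingTest_of_ge hr h, abs_le]
    constructor <;> linarith [hu.1, hu.2, norm_nonneg p]
  · have hq : |paraboloid (u x) p C (y - x)| ≤ M + ‖p‖ + C := by
      have h1 : |⟪p, y - x⟫| ≤ ‖p‖ := (abs_real_inner_le_norm _ _).trans
        (mul_le_of_le_one_right (norm_nonneg _) (h.le.trans hr1))
      have h2 : ‖y - x‖ ^ 2 ≤ 1 := pow_le_one₀ (norm_nonneg _) (h.le.trans hr1)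
      have h3 := abs_le.1 h1
      unfold paraboloid
      rw [abs_le]
      constructor <;> nlinarith [hx.1, hx.2, h3.1, h3.2, sq_nonneg ‖y - x‖]
    have hq' := abs_le.1 hq
    have c0 := cutoff_nonneg r (y - x)
    have c1 := cutoff_le_one r (y - x)
    have : touchingTest u x p C η r y = cutoff r (y - x) * paraboloid (u x) p C (y - x) +
        (1 - cutoff r (y - x)) * (u y - η * levyWeight (y - x)) := by
      unfold touchingTest; ring
    have hM0 : 0 ≤ M := (abs_nonneg _).trans (hM 0)
    rw [this, abs_le]
    constructor <;> nlinarith [hu.1, hu.2, hq'.1, hq'.2, norm_nonneg p]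

lemma testAt_touchingTest {M : ℝ} (hu : Continuous u) (hr : 0 < r) (hr1 : r ≤ 1) (hη : 0 ≤ η)
    (hC : 0 ≤ C) (hM : ∀ y, |u y| ≤ M) : TestAt x (touchingTest u x p C η r) := by
  refine ⟨⟨_, abs_touchingTest_le hr hr1 hη hC hM⟩, continuous_touchingTest hu, ball x (r / 2),
    ball_mem_nhds x (half_pos hr), ?_⟩
  have h : ContDiff ℝ 2 fun y => paraboloid (u x) p C (y - x) :=
    (contDiff_paraboloid _ _ _).comp (contDiff_id.sub contDiff_const)
  exact h.contDiffOn.congr fun y hy => touchingTest_of_le hr (mem_ball_iff_norm.1 hy).le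

lemma touchingTest_lt (hr : 0 < r) (hη : 0 < η)
    (hq : ∀ z, ‖z‖ < r → paraboloid (u x) p C z ≤ u (x + z)) {y : Rd d} (hy : y ≠ x) :
    touchingTest u x p (C + η) η r y < u y := by
  have hyx : 0 < ‖y - x‖ := norm_pos_iff.2 (sub_ne_zero.2 hy)
  have hw : 0 < η * levyWeight (y - x) := mul_pos hη (lt_min one_pos (by positivity))
  rcases le_or_gt r ‖y - x‖ with h | h
  · rw [touchingTest_of_ge hr h]; linarith
  · have h1 := hq _ h
    rw [add_sub_cancel] at h1
    have h2 : 0 < u y - paraboloid (u x) p (C + η) (y - x) := by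
      have : 0 < η * ‖y - x‖ ^ 2 := by positivity
      unfold paraboloid at *
      linarith
    have c0 := cutoff_nonneg r (y - x)
    have c1 := cutoff_le_one r (y - x)
    unfold touchingTest
    rcases c0.eq_or_lt with h0 | h0
    · rw [← h0]; linarith
    · have := mul_pos h0 h2
      have := mul_nonneg (sub_nonneg.2 c1) hw.le
      linarith

end touchingTest

/-- A supersolution touched from below by a paraboloid satisfies the equation with the paraboloid
used on a small ball and the function itself outside. -/
lemma IsSuperSol.le_of_paraboloid_le {d : ℕ} {S : PsiSetting d} {Ω : Set (Rd d)}
    {g u : Rd d → ℝ} (h : IsSuperSol S Ω (fun _ => 0) g u) (hu : Continuous u) {M : ℝ}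
    (hM : ∀ y, |u y| ≤ M) {x p : Rd d} (hx : x ∈ Ω) {C η r : ℝ} (hr : 0 < r) (hr1 : r ≤ 1)
    (hη : 0 < η) (hC : 0 ≤ C) (hq : ∀ z, ‖z‖ < r → paraboloid (u x) p C z ≤ u (x + z)) :
    g x ≤ (C + η) * (∫ z in ball (0 : Rd d) r, levyWeight z * S.j ‖z‖) +
      η * (∫ z : Rd d, levyWeight z * S.j ‖z‖) -
      ∫ z in (ball (0 : Rd d) r)ᶜ, levyDiff u x p z * S.j ‖z‖ := by
  set φ := touchingTest u x p (C + η) η r with hφ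
  have hCη : 0 ≤ C + η := by positivity
  have key := h.2 x hx φ (testAt_touchingTest hu hr hr1 hη.le hCη hM) (touchingTest_self hr)
    fun y hy => touchingTest_lt hr hη hq hy
  rw [zero_mul, add_zero] at key
  refine key.trans ?_
  have hgrad : gradient φ x = p := gradient_touchingTest hr
  have hφx : φ x = u x := touchingTest_self hr
  set k : Rd d → ℝ := fun z => φ x - φ (x + z) + if ‖z‖ ≤ 1 then ⟪z, p⟫ else 0 with hk
  have hop : psiOp S φ x = ∫ z, k z * S.j ‖z‖ := by simp only [psiOp, hgrad, hk]
  have hφc : Continuous φ := continuous_touchingTest hu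
  have hkm : Measurable k := by
    refine Measurable.add (by fun_prop) (Measurable.ite ?_ (by fun_prop) measurable_const)
    exact measurableSet_le measurable_norm measurable_const
  have hφb := abs_touchingTest_le (x := x) (p := p) hr hr1 hη.le hCη hM
  set B := 2 * M + η + ‖p‖ + (C + η) with hB
  have hB0 : 0 ≤ B := (abs_nonneg _).trans (hφb x)
  have hkB : ∀ z, |k z| ≤ 2 * B + ‖p‖ := fun z => by
    have h1 := abs_le.1 (hφb (x + z))
    have h2 := abs_le.1 (hφb x)
    have h3 := abs_le.1 (abs_ite_inner_le p z)
    simp only [hk]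
    rw [abs_le]
    constructor <;> linarith [h1.1, h1.2, h2.1, h2.2, h3.1, h3.2]
  have hcompl : IntegrableOn (fun z => k z * S.j ‖z‖) (ball 0 r)ᶜ :=
    S.integrableOn_compl_ball_mul_j hr hkm.aestronglyMeasurable hkB
  have hwball : IntegrableOn (fun z : Rd d => levyWeight z * S.j ‖z‖) (ball 0 r) :=
    S.integrable_levyWeight_mul_j.integrableOn
  have hwcompl : IntegrableOn (fun z : Rd d => levyWeight z * S.j ‖z‖) (ball 0 r)ᶜ :=
    S.integrable_levyWeight_mul_j.integrableOn
  have hdiff : IntegrableOn (fun z => levyDiff u x p z * S.j ‖z‖) (ball 0 r)ᶜ :=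
    S.integrableOn_compl_ball_mul_j hr (measurable_levyDiff hu x p).aestronglyMeasurable
      (abs_levyDiff_le hM x p)
  have hksmall : ∀ z, ‖z‖ ≤ r / 2 → k z = (C + η) * levyWeight z := fun z hz => by
    have h1 : ‖z‖ ≤ 1 := by linarith
    have h2 : φ (x + z) = paraboloid (u x) p (C + η) z := by
      rw [hφ, touchingTest_of_le hr (by simpa using hz), add_sub_cancel_left]
    simp only [hk, h2, hφx, paraboloid, if_pos h1, levyWeight_eq_sq h1, real_inner_comm]
    ring
  have hkint : Integrable fun z => k z * S.j ‖z‖ := by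
    have hr2 : 0 < min 1 ((r / 2) ^ 2) := lt_min one_pos (by positivity)
    refine S.integrable_mul_j (D := (C + η) + (2 * B + ‖p‖) / min 1 ((r / 2) ^ 2))
      hkm.aestronglyMeasurable fun z => ?_
    have hp := norm_nonneg p
    rcases le_or_gt ‖z‖ (r / 2) with hz | hz
    · rw [hksmall z hz, abs_of_nonneg (mul_nonneg hCη (levyWeight_nonneg z))]
      refine mul_le_mul_of_nonneg_right ?_ (levyWeight_nonneg z)
      have : 0 ≤ (2 * B + ‖p‖) / min 1 ((r / 2) ^ 2) := by positivity
      linarith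
    · have h1 : min 1 ((r / 2) ^ 2) ≤ levyWeight z := min_le_min le_rfl (by gcongr)
      have h2 : 2 * B + ‖p‖ ≤ (2 * B + ‖p‖) / min 1 ((r / 2) ^ 2) * levyWeight z := by
        rw [div_mul_eq_mul_div, le_div_iff₀ hr2]
        gcongr
      have h3 := mul_nonneg hCη (levyWeight_nonneg z)
      linarith [hkB z]
  have hball : ∫ z in ball (0 : Rd d) r, k z * S.j ‖z‖ ≤
      (C + η) * ∫ z in ball (0 : Rd d) r, levyWeight z * S.j ‖z‖ := by
    rw [← integral_const_mul]
    refine setIntegral_mono_on hkint.integrableOn (hwball.const_mul _) measurableSet_ball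
      fun z hz => ?_
    have hzr : ‖z‖ < r := mem_ball_zero_iff.1 hz
    have hz1 : ‖z‖ ≤ 1 := hzr.le.trans hr1
    rw [← mul_assoc]
    refine mul_le_mul_of_nonneg_right ?_ (S.j_nonneg _)
    have h1 := hq z hzr
    have c0 := cutoff_nonneg r z
    have c1 := cutoff_le_one r z
    have h2 : φ (x + z) = cutoff r z * paraboloid (u x) p (C + η) z +
        (1 - cutoff r z) * (u (x + z) - η * levyWeight z) := by
      rw [hφ, touchingTest, add_sub_cancel_left]; ring
    have h3 : paraboloid (u x) p (C + η) z ≤ u (x + z) - η * levyWeight z := by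
      rw [levyWeight_eq_sq hz1]
      unfold paraboloid at *
      linarith
    have h4 : paraboloid (u x) p (C + η) z ≤ φ (x + z) := by rw [h2]; nlinarith
    have h5 : paraboloid (u x) p (C + η) z = u x + ⟪z, p⟫ - (C + η) * levyWeight z := by
      rw [paraboloid, levyWeight_eq_sq hz1, real_inner_comm]
    simp only [hk, hφx, if_pos hz1]
    linarith
  have hout : ∫ z in (ball (0 : Rd d) r)ᶜ, k z * S.j ‖z‖ ≤
      η * (∫ z : Rd d, levyWeight z * S.j ‖z‖) -
      ∫ z in (ball (0 : Rd d) r)ᶜ, levyDiff u x p z * S.j ‖z‖ := by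
    have heq : ∫ z in (ball (0 : Rd d) r)ᶜ, k z * S.j ‖z‖ =
        ∫ z in (ball (0 : Rd d) r)ᶜ, (η * (levyWeight z * S.j ‖z‖) -
          levyDiff u x p z * S.j ‖z‖) := by
      refine setIntegral_congr_fun measurableSet_ball.compl fun z hz => ?_
      have hzr : r ≤ ‖z‖ := by simpa using hz
      have h2 : φ (x + z) = u (x + z) - η * levyWeight z := by
        rw [hφ, touchingTest_of_ge hr (by simpa using hzr), add_sub_cancel_left]
      simp only [hk, h2, hφx, levyDiff]
      ring
    rw [heq, integral_sub (hwcompl.const_mul _) hdiff, integral_const_mul]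
    refine sub_le_sub_right (mul_le_mul_of_nonneg_left ?_ hη.le) _
    exact setIntegral_le_integral S.integrable_levyWeight_mul_j
      (ae_of_all _ fun z => mul_nonneg (levyWeight_nonneg z) (S.j_nonneg _))
  rw [hop, ← integral_add_compl (measurableSet_ball (x := (0 : Rd d)) (ε := r)) hkint]
  linarith

lemma psiOp_neg {d : ℕ} (S : PsiSetting d) (φ : Rd d → ℝ) (x : Rd d) :
    psiOp S (fun y => -φ y) x = -psiOp S φ x := by
  have h : gradient (fun y => -φ y) x = -gradient φ x := by
    simp only [gradient, fderiv_fun_neg, map_neg]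
  unfold psiOp
  rw [← integral_neg, h]
  congr 1
  ext z
  split_ifs
  · rw [inner_neg_right]; ring
  · ring

lemma IsSubSol.isSuperSol_neg {d : ℕ} {S : PsiSetting d} {Ω : Set (Rd d)} {g u : Rd d → ℝ}
    (h : IsSubSol S Ω (fun _ => 0) g u) :
    IsSuperSol S Ω (fun _ => 0) (fun x => -g x) (fun x => -u x) := by
  refine ⟨h.1.neg, fun x hx φ hφ hφx hlt => ?_⟩
  obtain ⟨⟨M, hM⟩, hc, U, hU, hU2⟩ := hφ
  have := h.2 x hx (fun y => -φ y) ⟨⟨M, fun y => by rw [abs_neg]; exact hM y⟩, hc.neg, U, hU,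
    hU2.neg⟩ (by simp [hφx]) fun y hy => by linarith [hlt y hy]
  rw [psiOp_neg] at this
  linarith

lemma tendsto_volume_ball_nhds_zero {d : ℕ} [NeZero d] :
    Tendsto (fun r : ℝ => volume (ball (0 : Rd d) r)) (𝓝[>] 0) (𝓝 0) := by
  have h : Tendsto (fun r : ℝ => ENNReal.ofReal (r ^ d) * volume (ball (0 : Rd d) 1))
      (𝓝[>] 0) (𝓝 (ENNReal.ofReal (0 ^ d) * volume (ball (0 : Rd d) 1))) := by
    refine ENNReal.Tendsto.mul_const ?_ (Or.inr measure_ball_lt_top.ne)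
    refine ENNReal.tendsto_ofReal (Tendsto.mono_left ?_ nhdsWithin_le_nhds)
    exact (continuous_pow d).tendsto 0
  rw [zero_pow (NeZero.ne d), ENNReal.ofReal_zero, zero_mul] at h
  refine h.congr' ?_
  filter_upwards [self_mem_nhdsWithin] with r hr
  rw [Measure.addHaar_ball volume (0 : Rd d) (le_of_lt hr), finrank_euclideanSpace_fin]

lemma setIntegral_levyDiff_neg {d : ℕ} (S : PsiSetting d) (u : Rd d → ℝ) (L : Rd d ≃ₗᵢ[ℝ] Rd d)
    (y p : Rd d) (r : ℝ) :
    ∫ z in (ball (0 : Rd d) r)ᶜ, levyDiff (fun x => -u x) y (-(L p)) z * S.j ‖z‖ =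
      ∫ z in (ball (0 : Rd d) r)ᶜ, -levyDiff (fun x => u (y + L (x - y))) y p z * S.j ‖z‖ := by
  have hL : L ⁻¹' (ball (0 : Rd d) r)ᶜ = (ball (0 : Rd d) r)ᶜ := by
    ext z; simp
  rw [← L.measurePreserving.setIntegral_preimage_emb L.toHomeomorph.measurableEmbedding, hL]
  congr 1
  ext z
  simp only [levyDiff, LinearIsometryEquiv.norm_map, add_sub_cancel_left, sub_self, map_zero,
    add_zero, inner_neg_right, LinearIsometryEquiv.inner_map_map]
  split_ifs <;> ring

/-- Nonlocal maximum principle for two touching points `x`, `y` of a sub- and supersolution, with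
the increments at `y` turned by a linear isometry `L`. -/
lemma IsSol.sub_le_neg_setIntegral {d : ℕ} [NeZero d] {S : PsiSetting d} {Ω : Set (Rd d)}
    {g u : Rd d → ℝ} (h : IsSol S Ω (fun _ => 0) g u) (hu : Continuous u) {M : ℝ}
    (hM : ∀ y, |u y| ≤ M) (L : Rd d ≃ₗᵢ[ℝ] Rd d) {x y p : Rd d} (hx : x ∈ Ω) (hy : y ∈ Ω)
    {C δ : ℝ} (hC : 0 ≤ C) (hδ : 0 < δ) (hδ1 : δ ≤ 1)
    (hxp : ∀ z, ‖z‖ < δ → u x + ⟪p, z⟫ - C * ‖z‖ ^ 2 ≤ u (x + z))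
    (hyp : ∀ z, ‖z‖ < δ → u (y + L z) ≤ u y + ⟪p, z⟫ + C * ‖z‖ ^ 2)
    (hxy : ∀ z, ‖z‖ < δ → u (y + L z) - u y ≤ u (x + z) - u x) :
    g x - g y ≤ -∫ z in (ball (0 : Rd d) δ)ᶜ,
      ((u (x + z) - u x) - (u (y + L z) - u y)) * S.j ‖z‖ := by
  set c : Rd d → ℝ := fun z => (u (x + z) - u x) - (u (y + L z) - u y) with hc
  have hcc : Continuous c := by
    have := L.continuous
    fun_prop
  have hcM : ∀ z, |c z| ≤ 4 * M := fun z => by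
    have h1 := abs_le.1 (hM (x + z))
    have h2 := abs_le.1 (hM x)
    have h3 := abs_le.1 (hM (y + L z))
    have h4 := abs_le.1 (hM y)
    simp only [hc]
    rw [abs_le]
    constructor <;> linarith [h1.1, h1.2, h2.1, h2.2, h3.1, h3.2, h4.1, h4.2]
  have hv : Continuous fun x => u (y + L (x - y)) := by
    have := L.continuous
    fun_prop
  set I := ∫ z : Rd d, levyWeight z * S.j ‖z‖
  set J : ℝ → ℝ := fun r => ∫ z in ball (0 : Rd d) r, levyWeight z * S.j ‖z‖
  have hεle : ∀ ε, 0 < ε → ε < δ → g x - g y ≤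
      2 * ((C + ε) * J ε + ε * I) - ∫ z in (ball (0 : Rd d) δ)ᶜ, c z * S.j ‖z‖ := by
    intro ε hε hεδ
    have h1 := h.2.le_of_paraboloid_le hu hM (p := p) hx hε (hεδ.le.trans hδ1) hε hC
      fun z hz => hxp z (hz.trans hεδ)
    have h2 := h.1.isSuperSol_neg.le_of_paraboloid_le hu.neg (M := M)
      (fun z => by rw [abs_neg]; exact hM z) (p := -(L p)) hy hε (hεδ.le.trans hδ1) hε hC
      fun z hz => by
        have h3 := hyp (L.symm z) (by simpa using hz.trans hεδ)
        have h4 : ⟪p, L.symm z⟫ = ⟪L p, z⟫ := by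
          rw [← L.inner_map_map, L.apply_symm_apply]
        rw [L.apply_symm_apply, h4, LinearIsometryEquiv.norm_map] at h3
        simp only [paraboloid, inner_neg_left]
        linarith
    rw [setIntegral_levyDiff_neg] at h2
    have hi1 : IntegrableOn (fun z => levyDiff u x p z * S.j ‖z‖) (ball 0 ε)ᶜ :=
      S.integrableOn_compl_ball_mul_j hε (measurable_levyDiff hu x p).aestronglyMeasurable
        (abs_levyDiff_le hM x p)
    have hi2 : IntegrableOn (fun z => -levyDiff (fun x => u (y + L (x - y))) y p z * S.j ‖z‖)
        (ball 0 ε)ᶜ :=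
      S.integrableOn_compl_ball_mul_j hε (measurable_levyDiff hv y p).neg.aestronglyMeasurable
        fun z => by
          rw [abs_neg]
          exact abs_levyDiff_le (fun x => hM _) y p z
    have hsum : (∫ z in (ball (0 : Rd d) ε)ᶜ, levyDiff u x p z * S.j ‖z‖) +
        ∫ z in (ball (0 : Rd d) ε)ᶜ,
          -levyDiff (fun x => u (y + L (x - y))) y p z * S.j ‖z‖ =
        ∫ z in (ball (0 : Rd d) ε)ᶜ, c z * S.j ‖z‖ := by
      rw [← integral_add hi1 hi2]
      congr 1
      ext z
      simp only [levyDiff, hc, add_sub_cancel_left, sub_self, map_zero, add_zero]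
      ring
    have hmono : ∫ z in (ball (0 : Rd d) δ)ᶜ, c z * S.j ‖z‖ ≤
        ∫ z in (ball (0 : Rd d) ε)ᶜ, c z * S.j ‖z‖ := by
      rw [← integral_indicator measurableSet_ball.compl,
        ← integral_indicator measurableSet_ball.compl]
      refine integral_mono
        ((S.integrableOn_compl_ball_mul_j hδ hcc.aestronglyMeasurable hcM).integrable_indicator
          measurableSet_ball.compl)
        ((S.integrableOn_compl_ball_mul_j hε hcc.aestronglyMeasurable hcM).integrable_indicator
          measurableSet_ball.compl) fun z => ?_
      by_cases hz : z ∈ (ball (0 : Rd d) δ)ᶜ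
      · have hz' : z ∈ (ball (0 : Rd d) ε)ᶜ := compl_subset_compl.2 (ball_subset_ball hεδ.le) hz
        simp only [indicator_of_mem hz, indicator_of_mem hz', le_refl]
      · simp only [indicator_of_notMem hz]
        refine indicator_apply_nonneg fun _ => ?_
        have hz' : ‖z‖ < δ := by simpa using hz
        exact mul_nonneg (sub_nonneg.2 (hxy z hz')) (S.j_nonneg _)
    simp only [J, I]
    linarith
  have hJ : Tendsto J (𝓝[>] 0) (𝓝 0) :=
    S.integrable_levyWeight_mul_j.tendsto_setIntegral_nhds_zero tendsto_volume_ball_nhds_zero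
  have hid : Tendsto (fun ε : ℝ => ε) (𝓝[>] 0) (𝓝 0) := nhdsWithin_le_nhds
  have hlim : Tendsto (fun ε => 2 * ((C + ε) * J ε + ε * I) -
      ∫ z in (ball (0 : Rd d) δ)ᶜ, c z * S.j ‖z‖) (𝓝[>] 0)
      (𝓝 (2 * ((C + 0) * 0 + 0 * I) - ∫ z in (ball (0 : Rd d) δ)ᶜ, c z * S.j ‖z‖)) :=
    ((((hid.const_add C).mul hJ).add (hid.mul_const I)).const_mul 2).sub_const _
  simp only [mul_zero, zero_mul, add_zero, zero_sub] at hlim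
  refine ge_of_tendsto hlim ?_
  filter_upwards [Ioo_mem_nhdsGT hδ] with ε hε
  exact hεle ε hε.1 hε.2

/-- The linear part of the reflections `reflAt e lam`. -/
def reflLinear {d : ℕ} (e : Rd d) : Rd d ≃ₗᵢ[ℝ] Rd d := (ℝ ∙ e)ᗮ.reflection

lemma reflLinear_apply {d : ℕ} {e : Rd d} (he : ‖e‖ = 1) (x : Rd d) :
    reflLinear e x = x - (2 * ⟪x, e⟫) • e := by
  rw [reflLinear, Submodule.reflection_orthogonal_apply, Submodule.reflection_singleton_apply, he,
    real_inner_comm]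
  simp only [RCLike.ofReal_real_eq_id, id_eq, one_pow, div_one, mul_smul, two_smul, neg_sub]

lemma reflAt_eq {d : ℕ} {e : Rd d} (he : ‖e‖ = 1) (lam : ℝ) (x : Rd d) :
    reflAt e lam x = reflLinear e x + (2 * lam) • e := by
  rw [reflLinear_apply he, reflAt, sub_smul]; abel

lemma reflAt_add {d : ℕ} {e : Rd d} (he : ‖e‖ = 1) (lam : ℝ) (x z : Rd d) :
    reflAt e lam (x + z) = reflAt e lam x + reflLinear e z := by
  rw [reflAt_eq he, reflAt_eq he, map_add]; abel

lemma inner_self_of_norm_one {d : ℕ} {e : Rd d} (he : ‖e‖ = 1) : ⟪e, e⟫ = 1 := by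
  rw [real_inner_self_eq_norm_sq, he, one_pow]

lemma inner_reflAt {d : ℕ} {e : Rd d} (he : ‖e‖ = 1) (lam : ℝ) (x : Rd d) :
    ⟪reflAt e lam x, e⟫ = 2 * lam - ⟪x, e⟫ := by
  rw [reflAt, inner_sub_left, inner_smul_left, inner_self_of_norm_one he]
  simp; ring

lemma reflAt_reflAt {d : ℕ} {e : Rd d} (he : ‖e‖ = 1) (lam : ℝ) (x : Rd d) :
    reflAt e lam (reflAt e lam x) = x := by
  conv_lhs => rw [reflAt, inner_reflAt he, reflAt]
  rw [sub_sub, ← add_smul]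
  ring_nf
  simp

lemma reflAt_of_inner_eq {d : ℕ} {e : Rd d} {lam : ℝ} {x : Rd d} (hx : ⟪x, e⟫ = lam) :
    reflAt e lam x = x := by
  rw [reflAt, hx, sub_self, zero_smul, sub_zero]

lemma continuous_reflAt {d : ℕ} (e : Rd d) (lam : ℝ) : Continuous (reflAt e lam) := by
  unfold reflAt; fun_prop

lemma norm_sq_reflAt {d : ℕ} {e : Rd d} (he : ‖e‖ = 1) (lam : ℝ) (x : Rd d) :
    ‖reflAt e lam x‖ ^ 2 = ‖x‖ ^ 2 + 4 * lam * (lam - ⟪x, e⟫) := by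
  rw [reflAt, norm_sub_sq_real, norm_smul, inner_smul_right, he, mul_one, Real.norm_eq_abs, sq_abs]
  ring

lemma measurePreserving_reflAt {d : ℕ} {e : Rd d} (he : ‖e‖ = 1) (lam : ℝ) :
    MeasurePreserving (reflAt e lam) := by
  have h := (measurePreserving_add_right volume ((2 * lam) • e)).comp
    (reflLinear e).measurePreserving
  rwa [show (fun x => x + (2 * lam) • e) ∘ reflLinear e = reflAt e lam from
    funext fun x => (reflAt_eq he lam x).symm] at h

lemma measurableEmbedding_reflAt {d : ℕ} {e : Rd d} (he : ‖e‖ = 1) (lam : ℝ) :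
    MeasurableEmbedding (reflAt e lam) :=
  (Homeomorph.mk ⟨reflAt e lam, reflAt e lam, reflAt_reflAt he lam, reflAt_reflAt he lam⟩
    (continuous_reflAt e lam) (continuous_reflAt e lam)).measurableEmbedding

/-- At a negative minimum over a half-space, the nonlocal operator of an antisymmetric function has
a strict sign. -/
lemma setIntegral_sub_min_pos {d : ℕ} [NeZero d] (S : PsiSetting d) {e : Rd d} (he : ‖e‖ = 1)
    {h δ : ℝ} (hδ : 0 < δ) (hδh : δ ≤ h) {W : Rd d → ℝ} (hW : Continuous W) {M : ℝ}
    (hM : ∀ z, |W z| ≤ M) (hanti : ∀ z, W (reflAt e h z) = -W z)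
    (hneg : ∀ z, ‖z‖ < δ → W z < 0) (hmin : ∀ z, ⟪z, e⟫ ≤ h → W 0 ≤ W z) :
    0 < ∫ z in (ball (0 : Rd d) δ)ᶜ, (W z - W 0) * S.j ‖z‖ := by
  have hm : W 0 < 0 := hneg 0 (by simpa using hδ)
  set F : Rd d → ℝ := (ball (0 : Rd d) δ)ᶜ.indicator fun z => (W z - W 0) * S.j ‖z‖ with hF
  have hFi : Integrable F := by
    refine (S.integrableOn_compl_ball_mul_j (k := fun z => W z - W 0) hδ
      (hW.sub continuous_const).aestronglyMeasurable (M := 2 * M) fun z => ?_).integrable_indicator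
      measurableSet_ball.compl
    have h1 := abs_le.1 (hM z)
    have h2 := abs_le.1 (hM 0)
    rw [abs_le]
    constructor <;> linarith [h1.1, h1.2, h2.1, h2.2]
  have hpres := measurePreserving_reflAt he h
  have hemb := measurableEmbedding_reflAt he h
  have hFR : Integrable fun z => F (reflAt e h z) := (hpres.integrable_comp_emb hemb).2 hFi
  have hFin : ∀ z, ‖z‖ < δ → F z = 0 := fun z hz => indicator_of_notMem (by simpa using hz) _
  have hFout : ∀ z, δ ≤ ‖z‖ → F z = (W z - W 0) * S.j ‖z‖ := fun z hz =>
    indicator_of_mem (by simpa using hz) _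
  have hhalf : ∀ z, ⟪z, e⟫ ≤ h → z ≠ 0 → 0 < F z + F (reflAt e h z) := by
    intro z hz hz0
    have hRz : δ ≤ ‖reflAt e h z‖ := by
      have h1 := real_inner_le_norm (reflAt e h z) e
      rw [inner_reflAt he, he, mul_one] at h1
      linarith
    have hzR : ‖z‖ ≤ ‖reflAt e h z‖ := by
      refine le_of_sq_le_sq ?_ (norm_nonneg _)
      rw [norm_sq_reflAt he]
      have : 0 ≤ h * (h - ⟪z, e⟫) := mul_nonneg (by linarith) (by linarith)
      linarith
    have hzpos : 0 < ‖z‖ := norm_pos_iff.2 hz0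
    have hj := S.j_le_j hzpos hzR
    have hj0 := S.j_pos (hzpos.trans_le hzR)
    rw [hFout _ hRz, hanti]
    rcases lt_or_ge ‖z‖ δ with hzδ | hzδ
    · rw [hFin z hzδ, zero_add]
      exact mul_pos (by linarith [hneg z hzδ]) hj0
    · rw [hFout z hzδ]
      have := mul_le_mul_of_nonneg_left hj (sub_nonneg.2 (hmin z hz))
      nlinarith
  have hpos : ∀ z, z ≠ 0 → reflAt e h z ≠ 0 → 0 < F z + F (reflAt e h z) := by
    intro z hz hRz
    rcases le_total ⟪z, e⟫ h with hle | hle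
    · exact hhalf z hle hz
    · have := hhalf (reflAt e h z) (by rw [inner_reflAt he]; linarith) hRz
      rwa [reflAt_reflAt he, add_comm] at this
  have h0 : ∀ᵐ z : Rd d, z ≠ 0 := compl_mem_ae_iff.2 (measure_singleton 0)
  have h1 : ∀ᵐ z : Rd d, reflAt e h z ≠ 0 := hpres.quasiMeasurePreserving.ae h0
  have hae : ∀ᵐ z : Rd d, 0 < F z + F (reflAt e h z) := by
    filter_upwards [h0, h1] with z hz hz' using hpos z hz hz'
  have hint : 0 < ∫ z, (F z + F (reflAt e h z)) := by
    rw [integral_pos_iff_support_of_nonneg_ae (hae.mono fun _ hz => hz.le) (hFi.add hFR)]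
    refine pos_iff_ne_zero.2 fun h => NeZero.ne (volume : Measure (Rd d)) ?_
    rw [← ae_eq_bot, ← Filter.empty_mem_iff_bot]
    filter_upwards [hae, compl_mem_ae_iff.2 h] with z hz hz'
    exact hz' hz.ne'
  rw [integral_add hFi hFR, hpres.integral_comp hemb F] at hint
  rw [← integral_indicator measurableSet_ball.compl]
  linarith

lemma add_reflAt_sub {d : ℕ} (e a z : Rd d) (lam : ℝ) :
    a + reflAt e (lam - ⟪a, e⟫) z = reflAt e lam (a + z) := by
  simp only [reflAt, inner_add_left]
  module

lemma norm_le_norm_reflAt_add {d : ℕ} {e : Rd d} (he : ‖e‖ = 1) (lam : ℝ) (x : Rd d) :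
    ‖x‖ ≤ ‖reflAt e lam x‖ + 2 * |lam| := by
  have h1 : reflLinear e x = reflAt e lam x - (2 * lam) • e := by
    rw [reflAt_eq he, add_sub_cancel_right]
  calc ‖x‖ = ‖reflAt e lam x - (2 * lam) • e‖ := by rw [← h1, LinearIsometryEquiv.norm_map]
    _ ≤ ‖reflAt e lam x‖ + ‖(2 * lam) • e‖ := norm_sub_le _ _
    _ = _ := by rw [norm_smul, he, mul_one, Real.norm_eq_abs, abs_mul, abs_two]

/-- The doubled-variables functional whose minimizers approximate those of `u - u ∘ R`. -/
def doubled {d : ℕ} (u : Rd d → ℝ) (e : Rd d) (lam c : ℝ) (x y : Rd d) : ℝ :=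
  u x - u (reflAt e lam y) + c * ‖x - y‖ ^ 2

lemma exists_doubled_min {d : ℕ} {u : Rd d → ℝ} (hu : Continuous u) {A : ℝ}
    (hbound : ∀ x, 0 ≤ u x ∧ u x ≤ A) {e : Rd d} {lam m B : ℝ}
    (hm0 : 0 < m) (hB : ∀ y, m ≤ u (reflAt e lam y) → ‖y‖ ≤ B) {x₁ : Rd d} (hx₁ : ⟪x₁, e⟫ ≤ lam)
    (hm : u x₁ - u (reflAt e lam x₁) = -m) {c : ℝ} (hc : 1 ≤ c) :
    ∃ x y : Rd d, ‖x‖ ≤ B + A + 1 ∧ ⟪x, e⟫ ≤ lam ∧ ⟪y, e⟫ ≤ lam ∧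
      ∀ x' y', ⟪x', e⟫ ≤ lam → ⟪y', e⟫ ≤ lam → doubled u e lam c x y ≤ doubled u e lam c x' y' := by
  set K : Set (Rd d) := {x | ⟪x, e⟫ ≤ lam}
  have hK : IsClosed K := isClosed_le (by fun_prop) continuous_const
  set Q : Set (Rd d) := closedBall 0 (B + A + 1) ∩ K
  have hQ : IsCompact Q := (isCompact_closedBall _ _).inter_right hK
  have hA : 0 ≤ A := (hbound 0).1.trans (hbound 0).2
  have hcont : Continuous fun q : Rd d × Rd d => doubled u e lam c q.1 q.2 := by
    have := continuous_reflAt e lam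
    unfold doubled
    fun_prop
  have hsub : ∀ x y, ⟪x, e⟫ ≤ lam → ⟪y, e⟫ ≤ lam → doubled u e lam c x y ≤ -m →
      (x, y) ∈ Q ×ˢ Q := by
    intro x y hx hy hle
    unfold doubled at hle
    have h1 := hbound x
    have h2 := hbound (reflAt e lam y)
    have h3 : ‖x - y‖ ^ 2 ≤ c * ‖x - y‖ ^ 2 := le_mul_of_one_le_left (sq_nonneg _) hc
    have hy' : ‖y‖ ≤ B := hB y (by nlinarith [sq_nonneg ‖x - y‖])
    have h4 : ‖x - y‖ ≤ A + 1 := by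
      by_contra! hlt
      nlinarith
    have h5 : ‖x‖ ≤ ‖x - y‖ + ‖y‖ := by simpa using norm_add_le (x - y) y
    exact ⟨⟨by simpa using by linarith, hx⟩, ⟨by simpa using by linarith, hy⟩⟩
  have hx₁m : doubled u e lam c x₁ x₁ = -m := by simp [doubled, hm]
  have hx₁Q := hsub x₁ x₁ hx₁ hx₁ hx₁m.le
  obtain ⟨⟨x, y⟩, ⟨hx, hy⟩, hmin⟩ := (hQ.prod hQ).exists_isMinOn ⟨_, hx₁Q⟩ hcont.continuousOn
  refine ⟨x, y, by simpa using hx.1, hx.2, hy.2, fun x' y' hx' hy' => ?_⟩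
  have h1 : doubled u e lam c x y ≤ -m := hx₁m ▸ hmin hx₁Q
  rcases le_or_gt (doubled u e lam c x' y') (-m) with h | h
  · exact hmin (hsub x' y' hx' hy' h)
  · exact h1.trans h.le

/-- The increment inequalities at a minimizer of `doubled`. -/
lemma doubled_min_increments {d : ℕ} {u : Rd d → ℝ} {e : Rd d} (he : ‖e‖ = 1) {lam c : ℝ}
    {x y z : Rd d}
    (hmin : ∀ x' y', ⟪x', e⟫ ≤ lam → ⟪y', e⟫ ≤ lam →
      doubled u e lam c x y ≤ doubled u e lam c x' y')
    (hx : ⟪x, e⟫ ≤ lam) (hy : ⟪y, e⟫ ≤ lam) (hxz : ⟪x + z, e⟫ ≤ lam) (hyz : ⟪y + z, e⟫ ≤ lam) :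
    u x + ⟪(-(2 * c)) • (x - y), z⟫ - c * ‖z‖ ^ 2 ≤ u (x + z) ∧
    u (reflAt e lam y + reflLinear e z) ≤
      u (reflAt e lam y) + ⟪(-(2 * c)) • (x - y), z⟫ + c * ‖z‖ ^ 2 ∧
    u (reflAt e lam y + reflLinear e z) - u (reflAt e lam y) ≤ u (x + z) - u x := by
  have h1 := hmin _ _ hxz hy
  have h2 := hmin _ _ hx hyz
  have h3 := hmin _ _ hxz hyz
  simp only [doubled, add_sub_add_right_eq_sub, reflAt_add he] at h1 h2 h3
  rw [show x + z - y = (x - y) + z by abel, norm_add_sq_real (x - y) z] at h1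
  rw [show x - (y + z) = (x - y) - z by abel, norm_sub_sq_real (x - y) z] at h2
  rw [real_inner_smul_left]
  refine ⟨by linarith, by linarith, by linarith⟩

lemma exists_bound_of_tendsto_cocompact {d : ℕ} {u : Rd d → ℝ}
    (hdecay : Tendsto u (cocompact (Rd d)) (𝓝 0)) {m : ℝ} (hm : 0 < m) :
    ∃ B, ∀ y, m ≤ u y → ‖y‖ ≤ B := by
  obtain ⟨t, ht, hts⟩ := mem_cocompact.1 (hdecay.eventually (gt_mem_nhds hm))
  obtain ⟨B, hB⟩ := ht.isBounded.exists_norm_le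
  refine ⟨B, fun y hy => hB y ?_⟩
  by_contra hyt
  exact absurd (hts hyt) (not_lt.2 hy)

/-- Reflected comparison: once the reflection of the cap of `G` lies in `G`, the solution
dominates its reflection on the half-space `{x·e < lam}`. -/
theorem reflAt_le_of_isSol {d : ℕ} [NeZero d] {S : PsiSetting d} {G : Set (Rd d)}
    (hGclosed : IsClosed G) {A : ℝ} {f : ℝ → ℝ} (hfc : ContinuousOn f (Set.Icc 0 A))
    (hmono : AntitoneOn f (Set.Icc 0 A)) {u : Rd d → ℝ}
    (hsol : IsSol S Gᶜ (fun _ => 0) (fun x => f (u x)) u) (hG : ∀ x ∈ G, u x = A)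
    (hbound : ∀ x, 0 ≤ u x ∧ u x ≤ A) (hdecay : Tendsto u (cocompact (Rd d)) (𝓝 0))
    {e : Rd d} (he : ‖e‖ = 1) {lam : ℝ}
    (hrefl : ∀ x ∈ G, lam < ⟪x, e⟫ → reflAt e lam x ∈ G) {x₁ : Rd d} (hx₁ : ⟪x₁, e⟫ < lam) :
    u (reflAt e lam x₁) ≤ u x₁ := by
  by_contra! hlt
  have hu : Continuous u := continuous_iff_lower_upperSemicontinuous.2 ⟨hsol.2.1, hsol.1.1⟩
  have hM : ∀ x, |u x| ≤ A := fun x => by rw [abs_of_nonneg (hbound x).1]; exact (hbound x).2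
  have hR := continuous_reflAt e lam
  set m := u (reflAt e lam x₁) - u x₁ with hm
  have hm0 : 0 < m := sub_pos.2 hlt
  obtain ⟨B, hB⟩ := exists_bound_of_tendsto_cocompact hdecay hm0
  have hB' : ∀ y, m ≤ u (reflAt e lam y) → ‖y‖ ≤ B + 2 * |lam| := fun y hy =>
    (norm_le_norm_reflAt_add he lam y).trans (by linarith [hB _ hy])
  have hex := fun n : ℕ => exists_doubled_min hu hbound hm0 hB' hx₁.le (by rw [hm]; ring)
    (c := (n : ℝ) + 1) (by linarith [n.cast_nonneg (α := ℝ)])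
  choose xs ys hxsB hxs hys hmin using hex
  obtain ⟨a, -, φ, hφ, hxa⟩ :=
    (isCompact_closedBall (0 : Rd d) (B + 2 * |lam| + A + 1)).tendsto_subseq (x := xs) fun n => by simpa using hxsB n
  have hdist : ∀ n, ‖xs n - ys n‖ ^ 2 ≤ A * (1 / ((n : ℝ) + 1)) := fun n => by
    have h1 := hmin n x₁ x₁ hx₁.le hx₁.le
    have h2 := (hbound (xs n)).1
    have h3 := (hbound (reflAt e lam (ys n))).2
    simp only [doubled, sub_self, norm_zero] at h1
    rw [mul_one_div, le_div_iff₀ (by positivity)]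
    nlinarith
  have hsq : Tendsto (fun n => ‖xs n - ys n‖ ^ 2) atTop (𝓝 0) := by
    have h := (tendsto_one_div_add_atTop_nhds_zero_nat (𝕜 := ℝ)).const_mul A
    rw [mul_zero] at h
    exact squeeze_zero (fun n => sq_nonneg _) hdist h
  have hxy : Tendsto (fun n => xs n - ys n) atTop (𝓝 0) := by
    rw [tendsto_zero_iff_norm_tendsto_zero]
    simpa [Real.sqrt_sq (norm_nonneg _)] using hsq.sqrt
  have hya : Tendsto (ys ∘ φ) atTop (𝓝 a) := by
    have h := hxa.sub (hxy.comp hφ.tendsto_atTop)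
    simpa [Function.comp_def] using h
  have hux : Tendsto (fun n => u (xs (φ n))) atTop (𝓝 (u a)) := (hu.tendsto a).comp hxa
  have hRy : Tendsto (fun n => reflAt e lam (ys (φ n))) atTop (𝓝 (reflAt e lam a)) :=
    (hR.tendsto a).comp hya
  have huy : Tendsto (fun n => u (reflAt e lam (ys (φ n)))) atTop (𝓝 (u (reflAt e lam a))) :=
    (hu.tendsto _).comp hRy
  have hamin : ∀ x, ⟪x, e⟫ ≤ lam → u a - u (reflAt e lam a) ≤ u x - u (reflAt e lam x) := by
    intro x hx
    refine le_of_tendsto (hux.sub huy) (Eventually.of_forall fun n => ?_)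
    have h1 := hmin (φ n) x x hx hx
    simp only [doubled, sub_self, norm_zero] at h1
    have : 0 ≤ ((φ n : ℝ) + 1) * ‖xs (φ n) - ys (φ n)‖ ^ 2 := by positivity
    linarith
  have hale : ⟪a, e⟫ ≤ lam :=
    le_of_tendsto ((hxa.inner tendsto_const_nhds)) (Eventually.of_forall fun n => hxs (φ n))
  have haneg : u a < u (reflAt e lam a) := by
    have := hamin x₁ hx₁.le
    linarith
  have halt : ⟪a, e⟫ < lam := by
    refine hale.lt_of_ne fun h => ?_
    rw [reflAt_of_inner_eq h] at haneg
    exact lt_irrefl _ haneg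
  have haG : a ∈ Gᶜ := fun h => by
    rw [hG a h] at haneg
    exact absurd (hbound (reflAt e lam a)).2 (not_le.2 haneg)
  have hRaG : reflAt e lam a ∈ Gᶜ := fun h => by
    have := hrefl _ h (by rw [inner_reflAt he]; linarith)
    rw [reflAt_reflAt he] at this
    exact haG this
  set W : Rd d → ℝ := fun z => u (a + z) - u (reflAt e lam (a + z)) with hW
  have hWc : Continuous W := by fun_prop
  have hW0 : W 0 < 0 := by simp only [hW, add_zero]; linarith
  obtain ⟨δ₀, hδ₀, hδ₀W⟩ := Metric.eventually_nhds_iff_ball.1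
    (hWc.continuousAt.eventually (gt_mem_nhds hW0))
  set h := lam - ⟪a, e⟫ with hh
  have hh0 : 0 < h := sub_pos.2 halt
  obtain ⟨δ, hδ, hδle⟩ : ∃ δ, 0 < δ ∧ δ ≤ min δ₀ (min 1 (h / 2)) := ⟨_, by positivity, le_rfl⟩
  obtain ⟨hδ1, hδ2, hδ3⟩ : δ ≤ δ₀ ∧ δ ≤ 1 ∧ δ ≤ h / 2 := by simpa using hδle
  have hpos := setIntegral_sub_min_pos S he hδ (h := h) (by linarith) hWc (M := A)
    (fun z => by
      have h1 := hbound (a + z)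
      have h2 := hbound (reflAt e lam (a + z))
      rw [abs_le]
      constructor <;> simp only [hW] <;> linarith)
    (fun z => by
      simp only [hW, hh, add_reflAt_sub, reflAt_reflAt he]; ring)
    (fun z hz => hδ₀W z (by simpa using hz.trans_le hδ1))
    (fun z hz => by
      simp only [hW, add_zero]
      exact hamin _ (by rw [inner_add_left]; linarith))
  set F : ℕ → Rd d → ℝ := fun n z => ((u (xs (φ n) + z) - u (xs (φ n))) -
    (u (reflAt e lam (ys (φ n)) + reflLinear e z) - u (reflAt e lam (ys (φ n))))) with hF
  have hFc : ∀ n, Continuous (F n) := fun n => by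
    have := (reflLinear e).continuous
    fun_prop
  have hclose : ∀ {s : Rd d}, dist s a < δ → ∀ z, ‖z‖ < δ → ⟪s + z, e⟫ ≤ lam := by
    intro s hs z hz
    have h1 := real_inner_le_norm (s - a) e
    have h2 := real_inner_le_norm z e
    rw [he, mul_one] at h1 h2
    rw [dist_eq_norm] at hs
    rw [inner_sub_left] at h1
    rw [inner_add_left]
    linarith
  have hev : ∀ᶠ n in atTop, f (u (xs (φ n))) - f (u (reflAt e lam (ys (φ n)))) ≤
      -∫ z in (ball (0 : Rd d) δ)ᶜ, F n z * S.j ‖z‖ := by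
    filter_upwards [hxa.eventually (ball_mem_nhds a hδ), hya.eventually (ball_mem_nhds a hδ),
      hxa.eventually (hGclosed.isOpen_compl.mem_nhds haG),
      hRy.eventually (hGclosed.isOpen_compl.mem_nhds hRaG)] with n h1 h2 h3 h4
    have hinc := fun z (hz : ‖z‖ < δ) => doubled_min_increments he (hmin (φ n)) (hxs (φ n))
      (hys (φ n)) (hclose h1 z hz) (hclose h2 z hz)
    exact hsol.sub_le_neg_setIntegral hu hM (reflLinear e) h3 h4 (C := (φ n : ℝ) + 1)
      (by positivity) hδ hδ2 (fun z hz => (hinc z hz).1) (fun z hz => (hinc z hz).2.1)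
      fun z hz => (hinc z hz).2.2
  have hlim : Tendsto (fun n => ∫ z in (ball (0 : Rd d) δ)ᶜ, F n z * S.j ‖z‖) atTop
      (𝓝 (∫ z in (ball (0 : Rd d) δ)ᶜ, (W z - W 0) * S.j ‖z‖)) := by
    refine tendsto_integral_of_dominated_convergence (fun z => (4 * A) * S.j ‖z‖)
      (fun n => ((hFc n).measurable.mul S.measurable_j_norm).aestronglyMeasurable)
      (S.integrableOn_compl_ball_mul_j (k := fun _ => 4 * A) hδ aestronglyMeasurable_const
        fun _ => le_rfl) (fun n => ae_of_all _ fun z => ?_) (ae_of_all _ fun z => ?_)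
    · rw [norm_mul, Real.norm_of_nonneg (S.j_nonneg _)]
      refine mul_le_mul_of_nonneg_right ?_ (S.j_nonneg _)
      have h1 := hbound (xs (φ n) + z)
      have h2 := hbound (xs (φ n))
      have h3 := hbound (reflAt e lam (ys (φ n)) + reflLinear e z)
      have h4 := hbound (reflAt e lam (ys (φ n)))
      simp only [hF]
      rw [Real.norm_eq_abs, abs_le]
      constructor <;> linarith
    · refine Tendsto.mul_const _ ?_
      have h1 : W z - W 0 = (u (a + z) - u a) -
          (u (reflAt e lam a + reflLinear e z) - u (reflAt e lam a)) := by
        simp only [hW, add_zero, reflAt_add he, map_zero]; ring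
      rw [h1]
      exact (((hu.tendsto _).comp (hxa.add_const z)).sub hux).sub
        (((hu.tendsto _).comp (hRy.add_const (reflLinear e z))).sub huy)
  have hfu : Continuous fun x => f (u x) := hfc.comp_continuous hu hbound
  have hfin := le_of_tendsto_of_tendsto
    (((hfu.tendsto a).comp hxa).sub ((hfu.tendsto _).comp hRy)) hlim.neg hev
  have := hmono (hbound a) (hbound (reflAt e lam a)) haneg.le
  linarith

lemma hasC2BoundaryClosed_iUnion {d n : ℕ} {G : Fin n → Set (Rd d)}
    (hGclosed : ∀ k, IsClosed (G k)) (hGC2 : ∀ k, HasC2BoundaryClosed (G k))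
    (hGdisj : ∀ k l, k ≠ l → Disjoint (G k) (G l)) : HasC2BoundaryClosed (⋃ k, G k) := by
  intro x hx
  have hcl : IsClosed (⋃ k, G k) := isClosed_iUnion_of_finite hGclosed
  obtain ⟨k, hk⟩ := mem_iUnion.1 (hcl.frontier_subset hx)
  have hxk : x ∈ frontier (G k) := by
    rw [(hGclosed k).frontier_eq]
    rw [hcl.frontier_eq] at hx
    exact ⟨hk, fun h => hx.2 (interior_mono (subset_iUnion G k) h)⟩
  obtain ⟨U, f, hU, hxU, hf, hf', hGU⟩ := hGC2 k x hxk
  set N : Set (Rd d) := (⋃ l : {l // l ≠ k}, G l)ᶜ with hN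
  have hNo : IsOpen N := (isClosed_iUnion_of_finite fun l => hGclosed _).isOpen_compl
  have hxN : x ∈ N := by
    simp only [hN, mem_compl_iff, mem_iUnion, not_exists]
    exact fun l hl => (hGdisj _ _ l.2).le_bot ⟨hl, hk⟩
  refine ⟨U ∩ N, f, hU.inter hNo, ⟨hxU, hxN⟩, hf.mono inter_subset_left,
    fun y hy => hf' y hy.1, ?_⟩
  ext y
  have hy : y ∈ G k ∧ y ∈ U ↔ y ∈ U ∧ f y ≤ 0 := Set.ext_iff.1 hGU y
  constructor
  · rintro ⟨hyG, hyU, hyN⟩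
    obtain ⟨l, hl⟩ := mem_iUnion.1 hyG
    have hlk : l = k := by
      by_contra hne
      exact hyN (mem_iUnion.2 ⟨⟨l, hne⟩, hl⟩)
    subst hlk
    exact ⟨⟨hyU, hyN⟩, (hy.1 ⟨hl, hyU⟩).2⟩
  · rintro ⟨⟨hyU, hyN⟩, hyf⟩
    exact ⟨mem_iUnion.2 ⟨k, (hy.2 ⟨hyU, hyf⟩).1⟩, hyU, hyN⟩

/-- The reflection of the cap `{x ∈ G | lam < x·e}` lies in `G`. -/
def CapReflects {d : ℕ} (G : Set (Rd d)) (e : Rd d) (lam : ℝ) : Prop :=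
  ∀ x ∈ G, lam < ⟪x, e⟫ → reflAt e lam x ∈ G

lemma continuous_reflAt_uncurry {d : ℕ} (e : Rd d) :
    Continuous fun p : ℝ × Rd d => reflAt e p.1 p.2 := by
  unfold reflAt
  fun_prop

lemma CapReflects.of_forall_gt {d : ℕ} {G : Set (Rd d)} (hG : IsClosed G) {e : Rd d} {lam : ℝ}
    (h : ∀ μ, lam < μ → CapReflects G e μ) : CapReflects G e lam := by
  intro x hx hlt
  have hc : Tendsto (fun μ => reflAt e μ x) (𝓝[>] lam) (𝓝 (reflAt e lam x)) :=
    (((continuous_reflAt_uncurry e).comp (Continuous.prodMk_left x)).tendsto lam).mono_left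
      nhdsWithin_le_nhds
  refine hG.mem_of_tendsto hc ?_
  filter_upwards [self_mem_nhdsWithin, nhdsWithin_le_nhds (gt_mem_nhds hlt)] with μ h1 h2
  exact h μ h1 x hx h2

lemma sit1_of_reflAt_mem_frontier {d : ℕ} {G : Set (Rd d)} {e : Rd d} (he : ‖e‖ = 1) {lam : ℝ}
    (hcap : CapReflects G e lam) {x : Rd d} (hx : x ∈ G) (hlt : lam < ⟪x, e⟫)
    (hfr : reflAt e lam x ∈ frontier G) : Sit1 G e lam := by
  refine ⟨_, hfr, ⟨subset_closure ⟨x, ⟨hx, hlt⟩, rfl⟩, fun hint => hfr.2 ?_⟩, ?_⟩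
  · refine interior_mono ?_ hint
    rintro _ ⟨z, ⟨hz, hz'⟩, rfl⟩
    exact hcap z hz hz'
  · rw [inner_reflAt he]
    exact ne_of_lt (by linarith)

/-- The mean value theorem along a line segment. -/
lemma exists_sub_eq_mul_fderiv {E : Type*} [NormedAddCommGroup E] [NormedSpace ℝ E] {F : E → ℝ}
    {y e : E} {t : ℝ} (ht : 0 < t) (hF : ∀ s ∈ Set.Icc 0 t, DifferentiableAt ℝ F (y + s • e)) :
    ∃ s ∈ Set.Ioo 0 t, F (y + t • e) - F y = t * fderiv ℝ F (y + s • e) e := by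
  have hd : ∀ s ∈ Set.Icc 0 t,
      HasDerivAt (fun s => F (y + s • e)) (fderiv ℝ F (y + s • e) e) s := by
    intro s hs
    have h1 : HasDerivAt (fun s : ℝ => y + s • e) e s := by
      simpa using ((hasDerivAt_id s).smul_const e).const_add y
    exact (hF _ hs).hasFDerivAt.comp_hasDerivAt s h1
  obtain ⟨s, hs, hs'⟩ := exists_hasDerivAt_eq_slope _ _ ht
    (fun s hs => (hd s hs).continuousAt.continuousWithinAt)
    fun s hs => hd s (Ioo_subset_Icc_self hs)
  refine ⟨s, hs, ?_⟩
  rw [hs', sub_zero, mul_div_cancel₀ _ ht.ne', zero_smul, add_zero]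

/-- If points of `G` whose reflections leave `G` accumulate at a point of the hyperplane, then the
hyperplane is orthogonal to the boundary of `G` there. -/
lemma sit2_of_tendsto {d : ℕ} {G : Set (Rd d)} (hGC2 : HasC2BoundaryClosed G) {e : Rd d}
    (he : ‖e‖ = 1) {lam : ℝ} (hcap : CapReflects G e lam) {a : Rd d} (ha : ⟪a, e⟫ = lam)
    (hafr : a ∈ frontier G) {ls : ℕ → ℝ} {xs : ℕ → Rd d} (hxa : Tendsto xs atTop (𝓝 a))
    (hya : Tendsto (fun n => reflAt e (ls n) (xs n)) atTop (𝓝 a)) (hxs : ∀ n, xs n ∈ G)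
    (hlt : ∀ n, ls n < ⟪xs n, e⟫) (hys : ∀ n, reflAt e (ls n) (xs n) ∉ G) : Sit2 G e lam := by
  obtain ⟨U, F, hU, haU, hF, hF', hGU⟩ := hGC2 a hafr
  refine ⟨a, hafr, ha, U, F, hU, haU, hF, hF' a haU, hGU, ?_⟩
  have hGU' : ∀ y ∈ U, y ∈ G ↔ F y ≤ 0 := fun y hy =>
    ⟨fun h => ((Set.ext_iff.1 hGU y).1 ⟨h, hy⟩).2, fun h => ((Set.ext_iff.1 hGU y).2 ⟨hy, h⟩).1⟩
  have hdiff : ∀ z ∈ U, DifferentiableAt ℝ F z := fun z hz =>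
    (hF.contDiffAt (hU.mem_nhds hz)).differentiableAt (by norm_num)
  have hfc : ContinuousAt (fun z => fderiv ℝ F z e) a :=
    (((hF.contDiffAt (hU.mem_nhds haU)).fderiv_right (m := 1) (by norm_num)).continuousAt).clm_apply
      continuousAt_const
  refine le_antisymm ?_ ?_
  · by_contra! hpos
    obtain ⟨ε, hε, hball⟩ := Metric.eventually_nhds_iff_ball.1
      ((hfc.eventually (lt_mem_nhds hpos)).and (hU.mem_nhds haU))
    obtain ⟨n, hxn, hyn⟩ := ((hxa.eventually (ball_mem_nhds a hε)).and
      (hya.eventually (ball_mem_nhds a hε))).exists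
    set y := reflAt e (ls n) (xs n) with hy
    set t := 2 * ⟪xs n, e⟫ - 2 * ls n with ht
    have ht0 : 0 < t := by linarith [hlt n]
    have hyt : y + t • e = xs n := by simp only [hy, reflAt, ht]; abel
    have hseg : ∀ s ∈ Set.Icc 0 t, y + s • e ∈ ball a ε := by
      intro s hs
      have h := (convex_ball a ε).add_smul_sub_mem hyn hxn
        (t := s / t) ⟨div_nonneg hs.1 ht0.le, (div_le_one ht0).2 hs.2⟩
      rwa [← hyt, add_sub_cancel_left, smul_smul, div_mul_cancel₀ _ ht0.ne'] at h
    obtain ⟨s, hs, hs'⟩ := exists_sub_eq_mul_fderiv (F := F) ht0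
      fun s hs => hdiff _ (hball _ (hseg s hs)).2
    rw [hyt] at hs'
    have h1 := (hGU' _ (hball _ hxn).2).1 (hxs n)
    have h2 := mt (hGU' _ (hball _ hyn).2).2 (hys n)
    have h3 := mul_pos ht0 (hball _ (hseg s (Ioo_subset_Icc_self hs))).1
    linarith
  · by_contra! hneg
    obtain ⟨ε, hε, hball⟩ := Metric.eventually_nhds_iff_ball.1
      ((hfc.eventually (gt_mem_nhds hneg)).and (hU.mem_nhds haU))
    have hmem : ∀ s : ℝ, |s| < ε → a + s • e ∈ ball a ε := fun s hs => by
      simpa [dist_eq_norm, norm_smul, he] using hs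
    have haG : F a ≤ 0 := by
      refine le_of_tendsto ((hdiff a haU).continuousAt.tendsto.comp hxa) ?_
      filter_upwards [hxa.eventually (hU.mem_nhds haU)] with n hn using (hGU' _ hn).1 (hxs n)
    have haG' : 0 ≤ F a := by
      refine ge_of_tendsto ((hdiff a haU).continuousAt.tendsto.comp hya) ?_
      filter_upwards [hya.eventually (hU.mem_nhds haU)] with n hn
      exact (not_le.1 (mt (hGU' _ hn).2 (hys n))).le
    have hdec : ∀ b c : ℝ, |b| < ε → |c| < ε → b < c → F (a + c • e) < F (a + b • e) := by
      intro b c hb hc hbc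
      have hmem' : ∀ s ∈ Set.Icc 0 (c - b), a + b • e + s • e ∈ ball a ε := by
        intro s hs
        rw [add_assoc, ← add_smul]
        refine hmem _ ?_
        rw [abs_lt] at hb hc ⊢
        exact ⟨by linarith [hs.1], by linarith [hs.2]⟩
      obtain ⟨s, hs, hs'⟩ := exists_sub_eq_mul_fderiv (F := F) (sub_pos.2 hbc)
        fun s hs => hdiff _ (hball _ (hmem' s hs)).2
      rw [add_assoc, ← add_smul, add_sub_cancel] at hs'
      have := mul_neg_of_pos_of_neg (sub_pos.2 hbc) (hball _ (hmem' s (Ioo_subset_Icc_self hs))).1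
      linarith
    have hε2 : |ε / 2| < ε := by rw [abs_of_pos] <;> linarith
    have hε2' : |-(ε / 2)| < ε := by rwa [abs_neg]
    have h1 := hdec 0 (ε / 2) (by simpa using hε) hε2 (by linarith)
    have h2 := hdec (-(ε / 2)) 0 hε2' (by simpa using hε) (by linarith)
    rw [zero_smul, add_zero] at h1 h2
    have hinner : ⟪a + (ε / 2) • e, e⟫ = lam + ε / 2 := by
      rw [inner_add_left, real_inner_smul_left, inner_self_of_norm_one he, ha, mul_one]
    have hr : reflAt e lam (a + (ε / 2) • e) = a + (-(ε / 2)) • e := by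
      rw [reflAt, hinner]
      module
    have h3 := hcap _ ((hGU' _ (hball _ (hmem _ hε2)).2).2 (by linarith))
      (by rw [hinner]; linarith)
    rw [hr] at h3
    have h4 := (hGU' _ (hball _ (hmem _ hε2')).2).1 h3
    linarith

theorem capReflects_of_gt {d : ℕ} {G : Set (Rd d)} (hGc : IsCompact G)
    (hGC2 : HasC2BoundaryClosed G) {e : Rd d} (he : ‖e‖ = 1) {lam₀ : ℝ}
    (hlam₀ : ∀ lam, lam₀ < lam → ¬ (Sit1 G e lam ∨ Sit2 G e lam)) {μ : ℝ} (hμ : lam₀ < μ) :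
    CapReflects G e μ := by
  by_contra hμP
  obtain ⟨B, hB⟩ := hGc.isBounded.exists_norm_le
  set T : Set ℝ := {lam | ¬ CapReflects G e lam} with hT
  have hTB : BddAbove T := by
    refine ⟨B, fun lam hlam => ?_⟩
    by_contra! hlt
    refine hlam fun x hx hx' => absurd hx' (not_lt.2 ?_)
    have := real_inner_le_norm x e
    rw [he, mul_one] at this
    linarith [hB x hx]
  have hTne : T.Nonempty := ⟨μ, hμP⟩
  set l := sSup T with hl
  have hl₀ : lam₀ < l := hμ.trans_le (le_csSup hTB hμP)
  have hcap : CapReflects G e l := CapReflects.of_forall_gt hGc.isClosed fun ν hν => by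
    by_contra hνT
    exact absurd (le_csSup hTB hνT) (not_le.2 hν)
  obtain ⟨ls, -, hls, hlsT⟩ := exists_seq_tendsto_sSup hTne hTB
  have hfail : ∀ n, ∃ x ∈ G, ls n < ⟪x, e⟫ ∧ reflAt e (ls n) x ∉ G := fun n => by
    simpa [hT, CapReflects] using hlsT n
  choose xs hxs hlt hys using hfail
  obtain ⟨a, ha, φ, hφ, hxa⟩ := hGc.tendsto_subseq hxs
  have hla := hls.comp hφ.tendsto_atTop
  have hya : Tendsto (fun n => reflAt e (ls (φ n)) (xs (φ n))) atTop (𝓝 (reflAt e l a)) :=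
    ((continuous_reflAt_uncurry e).tendsto (l, a)).comp (hla.prodMk_nhds hxa)
  have hale : l ≤ ⟪a, e⟫ :=
    le_of_tendsto_of_tendsto' hla (hxa.inner tendsto_const_nhds) fun n => (hlt (φ n)).le
  have hnint : reflAt e l a ∉ interior G := fun hint => by
    obtain ⟨n, hn⟩ := (hya.eventually (isOpen_interior.mem_nhds hint)).exists
    exact hys _ (interior_subset hn)
  rcases hale.lt_or_eq with h | h
  · exact hlam₀ l hl₀ (Or.inl (sit1_of_reflAt_mem_frontier he hcap ha h
      ⟨subset_closure (hcap a ha h), hnint⟩))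
  · rw [reflAt_of_inner_eq h.symm] at hya hnint
    exact hlam₀ l hl₀ (Or.inr (sit2_of_tendsto hGC2 he hcap h.symm ⟨subset_closure ha, hnint⟩
      hxa hya (fun n => hxs _) (fun n => hlt _) fun n => hys _))

/-- **Lemma 4.5** (critical position under global monotonicity of `f`): in the
setting of Theorem 2.3, but with `f` non-increasing on all of `[0,A]` and only
`0 ≤ u ≤ A` required, one has `λ* = λ₀`. -/
theorem moving_plane_critical_eq_geometric_monotone
    {d : ℕ} (hd : 2 ≤ d) (S : PsiSetting d) (hker : S.kernelCond)
    (V : ℝ → ℝ) (hV : IsRenewal S.Ψ V)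
    (n : ℕ) (hn : 0 < n) (G : Fin n → Set (Rd d))
    (hGc : ∀ k, IsCompact (G k)) (hGconn : ∀ k, IsConnected (G k))
    (hGC2 : ∀ k, HasC2BoundaryClosed (G k))
    (hGdisj : ∀ k l, k ≠ l → Disjoint (G k) (G l))
    (A : ℝ) (hA : 0 < A)
    (f : ℝ → ℝ) (hf : ∃ L : ℝ≥0, LipschitzOnWith L f (Set.Icc 0 A))
    (hmono : AntitoneOn f (Set.Icc 0 A))
    (Ak : Fin n → ℝ) (hAk : ∀ k, Ak k ≤ 0)
    (u : Rd d → ℝ)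
    (β : ℝ) (hβ : 0 < β ∧ β < 1)
    (hHolder : ∃ C > (0:ℝ), ∀ x y, |u x - u y| ≤ C * ‖x - y‖ ^ β)
    (hsol : IsSol S ((⋃ k, G k)ᶜ) (fun _ => 0) (fun x => f (u x)) u)
    (hG : ∀ x ∈ ⋃ k, G k, u x = A)
    (htr : ∀ k, ∀ x ∈ frontier (G k),
      HasVTrace V ((⋃ k, G k)ᶜ) (fun z => u z - A) x (Ak k))
    (hbound : ∀ x, 0 ≤ u x ∧ u x ≤ A)
    (hdecay : Filter.Tendsto u (Filter.cocompact (Rd d)) (nhds 0))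
    (e : Rd d) (he : ‖e‖ = 1)
    (lam₀ : ℝ)
    (hlam₀ : IsGreatest
      {lam : ℝ | Sit1 (⋃ k, G k) e lam ∨ Sit2 (⋃ k, G k) e lam} lam₀)
    (lamStar : ℝ)
    (hlamStar : lamStar = sInf {lam : ℝ | lam₀ ≤ lam ∧
      ∀ μ : ℝ, lam < μ → ∀ x : Rd d, ⟪x, e⟫ < μ → 0 ≤ u x - u (reflAt e μ x)})
    :
    lamStar = lam₀ := by
  have : NeZero d := ⟨by omega⟩
  obtain ⟨L, hL⟩ := hf
  have hGc' : IsCompact (⋃ k, G k) := isCompact_iUnion hGc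
  have hC2 := hasC2BoundaryClosed_iUnion (fun k => (hGc k).isClosed) hGC2 hGdisj
  rw [hlamStar]
  refine IsLeast.csInf_eq ⟨⟨le_rfl, fun μ hμ x hx => ?_⟩, fun lam hlam => hlam.1⟩
  have hcap := capReflects_of_gt hGc' hC2 he
    (fun lam hlt h => absurd (hlam₀.2 h) (not_le.2 hlt)) hμ
  exact sub_nonneg.2 (reflAt_le_of_isSol hGc'.isClosed hL.continuousOn hmono hsol hG hbound hdecay
    he hcap hx)
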